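/- Let D be a parallel slit half-plane and (F_t)_{t∈[0,T]} a strictly increasing family of bounded ℍ-hulls contained in D whose closures are disjoint from the slits of D, with mapping-out functions g_t : D ∖ F_t → D_t as in the context. If (F_t)_{t∈[0,T]} has the local growth property, then there exists a continuous function ξ : [0,T] → ℝ such that for every t ∈ [0,T), ⋂_{δ>0} closure(g_t(F_{t+δ} ∖ F_t)) = {ξ(t)} (identifying the boundary ∂ℍ with ℝ). -/

import Mathlib

open Complex Set Filter Topology Bornology MeasureTheory Metric

noncomputable section

/-- The upper half-plane `ℍ = {z : ℂ | 0 < Im z}`. -/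
def UHP : Set ℂ := {z : ℂ | 0 < z.im}

/-- The half-plane `ℍ_η = {z : ℂ | η < Im z}`. -/
def HP (η : ℝ) : Set ℂ := {z : ℂ | η < z.im}

/-- The sector `△_θ = {z : ℂ | θ < arg z < π - θ}`. -/
def Sector (θ : ℝ) : Set ℂ :=
  {z : ℂ | θ < Complex.arg z ∧ Complex.arg z < Real.pi - θ}

/-- A closed horizontal line segment of positive length contained in `ℍ`. -/
def IsHorizontalSlit (C : Set ℂ) : Prop :=
  ∃ y xl xr : ℝ, 0 < y ∧ xl < xr ∧
    C = {z : ℂ | z.im = y ∧ z.re ∈ Set.Icc xl xr}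

/-- A parallel slit half-plane with `N` slits: `ℍ` minus `N` pairwise disjoint
closed horizontal segments of positive length. -/
def IsParallelSlitHalfPlaneN (N : ℕ) (D : Set ℂ) : Prop :=
  ∃ C : Fin N → Set ℂ,
    (∀ j, IsHorizontalSlit (C j)) ∧
    (Pairwise fun i j => Disjoint (C i) (C j)) ∧
    D = UHP \ ⋃ j, C j

/-- A parallel slit half-plane (with some number of slits). -/
def IsParallelSlitHalfPlane (D : Set ℂ) : Prop :=
  ∃ N : ℕ, IsParallelSlitHalfPlaneN N D

/-- (H.1): hydrodynamic normalization at infinity. -/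
def SatisfiesH1 (D : Set ℂ) (f : ℂ → ℂ) : Prop :=
  ∃ η : ℝ, 0 ≤ η ∧ HP η ⊆ D ∧
    Tendsto (fun z => f z - z) (cobounded ℂ ⊓ 𝓟 (HP η)) (𝓝 0)

/-- (H.2): `f` has angular residue `c` at infinity, i.e. `z (f z - z) → -c`
as `z → ∞` within every sector `△_θ`. -/
def SatisfiesH2 (f : ℂ → ℂ) (c : ℂ) : Prop :=
  ∀ θ : ℝ, 0 < θ → θ < Real.pi / 2 →
    Tendsto (fun z => z * (f z - z)) (cobounded ℂ ⊓ 𝓟 (Sector θ)) (𝓝 (-c))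

/-- `F` is an ℍ-hull: relatively closed in `ℍ` with `ℍ \ F` a simply connected
domain. -/
def IsHHull (F : Set ℂ) : Prop :=
  F ⊆ UHP ∧ closure F ∩ UHP ⊆ F ∧
    IsConnected (UHP \ F) ∧ SimplyConnectedSpace ↥(UHP \ F)

/-- `η_D = min {Im w | w ∈ ℍ \ D}`. -/
def etaD (D : Set ℂ) : ℝ := sInf (Complex.im '' (UHP \ D))

/-- A (chordal) evolution family `φ t s : D s → D t` (for `s ≤ t` in `I`) over
parallel slit half-planes `D t`, where `lam t` is the angular residue of
`φ t 0` at infinity. -/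
structure IsEvolutionFamily (I : Set ℝ) (D : ℝ → Set ℂ)
    (φ : ℝ → ℝ → ℂ → ℂ) (lam : ℝ → ℂ) : Prop where
  slit : ∀ t ∈ I, IsParallelSlitHalfPlane (D t)
  mapsTo : ∀ s ∈ I, ∀ t ∈ I, s ≤ t → Set.MapsTo (φ t s) (D s) (D t)
  holo : ∀ s ∈ I, ∀ t ∈ I, s ≤ t → DifferentiableOn ℂ (φ t s) (D s)
  inj : ∀ s ∈ I, ∀ t ∈ I, s ≤ t → Set.InjOn (φ t s) (D s)
  h1 : ∀ s ∈ I, ∀ t ∈ I, s ≤ t → SatisfiesH1 (D s) (φ t s)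
  h2 : ∀ s ∈ I, ∀ t ∈ I, s ≤ t → ∃ c : ℂ, SatisfiesH2 (φ t s) c
  h3 : ∀ s ∈ I, ∀ t ∈ I, s ≤ t → IsHHull (D t \ φ t s '' D s)
  ef1 : ∀ t ∈ I, Set.EqOn (φ t t) id (D t)
  ef2 : ∀ s ∈ I, ∀ t ∈ I, ∀ u ∈ I, s ≤ t → t ≤ u →
    ∀ z ∈ D s, φ u s z = φ u t (φ t s z)
  lam_res : ∀ t ∈ I, SatisfiesH2 (φ t 0) (lam t)
  ef3 : ContinuousOn lam I

/-- A (chordal) Loewner chain `f t : D t → Dcod` over parallel slit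
half-planes `D t` with codomain `Dcod`, where `ell t` is the angular residue
of `f t` at infinity. -/
structure IsLoewnerChain (I : Set ℝ) (D : ℝ → Set ℂ) (Dcod : Set ℂ)
    (f : ℝ → ℂ → ℂ) (ell : ℝ → ℂ) : Prop where
  slit : ∀ t ∈ I, IsParallelSlitHalfPlane (D t)
  slitcod : IsParallelSlitHalfPlane Dcod
  mapsTo : ∀ t ∈ I, Set.MapsTo (f t) (D t) Dcod
  holo : ∀ t ∈ I, DifferentiableOn ℂ (f t) (D t)
  inj : ∀ t ∈ I, Set.InjOn (f t) (D t)
  h1 : ∀ t ∈ I, SatisfiesH1 (D t) (f t)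
  h2 : ∀ t ∈ I, SatisfiesH2 (f t) (ell t)
  h3 : ∀ t ∈ I, IsHHull (Dcod \ f t '' D t)
  lc1 : ∀ s ∈ I, ∀ t ∈ I, s ≤ t → f s '' D s ⊆ f t '' D t
  lc2 : ContinuousOn ell I

/-- `(Lip)_μ`: Lipschitz continuity of `t ↦ f t` w.r.t. the measure `μ`,
uniformly on compact subsets of `D`. -/
def SatisfiesLip (I : Set ℝ) (μ : Measure ℝ) (D : Set ℂ)
    (f : ℝ → ℂ → ℂ) : Prop :=
  ∀ K : Set ℂ, K ⊆ D → IsCompact K → ∃ L : ℝ,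
    ∀ s ∈ I, ∀ t ∈ I, s ≤ t → ∀ z ∈ K,
      ‖f t z - f s z‖ ≤ L * (μ (Set.Ioc s t)).toReal

/-- `(AC)_μ`: absolute continuity of `t ↦ f t` w.r.t. the measure `μ`,
uniformly on compact subsets of `D`. -/
def SatisfiesAC (I : Set ℝ) (μ : Measure ℝ) (D : Set ℂ)
    (f : ℝ → ℂ → ℂ) : Prop :=
  ∀ K : Set ℂ, K ⊆ D → IsCompact K →
    ∃ ν : Measure ℝ, ν ≪ μ ∧
      (∀ a ∈ I, ∀ b ∈ I, ν (Set.Icc a b) < ⊤) ∧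
      ∀ s ∈ I, ∀ t ∈ I, s ≤ t → ∀ z ∈ K,
        ‖f t z - f s z‖ ≤ (ν (Set.Ioc s t)).toReal

/-- The symmetric difference quotient
`(f (t+δ) z - f (t-δ) z) / μ((t-δ, t+δ))`. -/
def symmQuot (μ : Measure ℝ) (f : ℝ → ℂ → ℂ) (t δ : ℝ) (z : ℂ) : ℂ :=
  (f (t + δ) z - f (t - δ) z) / ((μ (Set.Ioo (t - δ) (t + δ))).toReal : ℂ)

/-- A cross-cut of a domain `G`. -/
def IsCrossCut (G C : Set ℂ) : Prop :=
  ∃ c : ℝ → ℂ, ContinuousOn c (Set.Icc 0 1) ∧ Set.InjOn c (Set.Icc 0 1) ∧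
    c 0 ∈ frontier G ∧ c 1 ∈ frontier G ∧ c '' Set.Ioo 0 1 ⊆ G ∧
    C = c '' Set.Icc 0 1

/-- `C` separates `S` from `∞` in `G`: `S` is disjoint from the unbounded
connected component of `G \ C`. -/
def SeparatesFromInfty (G C S : Set ℂ) : Prop :=
  ∀ z ∈ S ∩ (G \ C), Bornology.IsBounded (connectedComponentIn (G \ C) z)

/-- The local growth property of a family of hulls `(F t)_{t ∈ [0,T]}` in `D`. -/
def LocalGrowth (T : ℝ) (D : Set ℂ) (F : ℝ → Set ℂ) : Prop :=
  ∀ ε : ℝ, 0 < ε → ∃ δ ∈ Set.Ioo 0 T, ∀ t ∈ Set.Icc 0 (T - δ),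
    ∃ C : Set ℂ, IsCrossCut (D \ F t) C ∧ Metric.diam C < ε ∧
      SeparatesFromInfty (D \ F t) C (F (t + δ) \ F t)

/-- Carathéodory kernel of a sequence of domains w.r.t. the point `a`. -/
def kernelAt (a : ℂ) (G : ℕ → Set ℂ) : Set ℂ :=
  connectedComponentIn
    {z : ℂ | ∃ r > 0, ∃ N : ℕ, ∀ n ≥ N, Metric.ball z r ⊆ G n} a

/-- Left continuity in Carathéodory's sense of `(F t)` at `t₀`. -/
def CaratheodoryLeftContinuousAt (D : Set ℂ) (F : ℝ → Set ℂ)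
    (T t₀ : ℝ) : Prop :=
  ∀ a ∈ D \ F T, ∀ s : ℕ → ℝ,
    Monotone s → (∀ n, s n ∈ Set.Ico 0 t₀) → Tendsto s atTop (𝓝 t₀) →
      kernelAt a (fun n => D \ F (s n)) = D \ F t₀

/-- Removing a closed set `K` from an open preconnected set keeps it preconnected, provided that
`K` has a neighbourhood `V` for which `V \ K` is preconnected. -/
lemma IsPreconnected.diff_of_nhd {U V K : Set ℂ} (hU : IsPreconnected U) (hUo : IsOpen U)
    (hVo : IsOpen V) (hVU : V ⊆ U) (hKV : K ⊆ V) (hK : IsClosed K)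
    (hVK : IsPreconnected (V \ K)) : IsPreconnected (U \ K) := by
  have key : ∀ u v : Set ℂ, IsOpen u → IsOpen v → U \ K ⊆ u ∪ v →
      (U \ K ∩ u).Nonempty → (U \ K ∩ v).Nonempty → V \ K ⊆ u →
      (U \ K ∩ (u ∩ v)).Nonempty := by
    intro u v hu hv huv hnu hnv hVu
    have hA : IsOpen (((U \ K) ∩ u) ∪ V) := ((hUo.sdiff hK).inter hu).union hVo
    have hB : IsOpen ((U \ K) ∩ v) := (hUo.sdiff hK).inter hv
    have hcov : U ⊆ (((U \ K) ∩ u) ∪ V) ∪ ((U \ K) ∩ v) := by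
      intro x hx
      by_cases hxK : x ∈ K
      · exact Or.inl (Or.inr (hKV hxK))
      · rcases huv ⟨hx, hxK⟩ with h | h
        · exact Or.inl (Or.inl ⟨⟨hx, hxK⟩, h⟩)
        · exact Or.inr ⟨⟨hx, hxK⟩, h⟩
    obtain ⟨x, hx, hxA, hxB⟩ := hU _ _ hA hB hcov
      (hnu.mono fun x hx => ⟨hx.1.1, Or.inl hx⟩) (hnv.mono fun x hx => ⟨hx.1.1, hx⟩)
    refine ⟨x, hxB.1, ?_, hxB.2⟩
    rcases hxA with h | h
    · exact h.2
    · exact hVu ⟨h, hxB.1.2⟩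
  intro u v hu hv huv hnu hnv
  by_cases h1 : (V \ K ∩ u).Nonempty
  · by_cases h2 : (V \ K ∩ v).Nonempty
    · obtain ⟨x, hx, hx'⟩ := hVK u v hu hv
        (fun x hx => huv ⟨hVU hx.1, hx.2⟩) h1 h2
      exact ⟨x, ⟨hVU hx.1, hx.2⟩, hx'⟩
    · refine key u v hu hv huv hnu hnv fun x hx => ?_
      rcases huv ⟨hVU hx.1, hx.2⟩ with h | h
      · exact h
      · exact absurd ⟨x, hx, h⟩ h2
  · rw [inter_comm u v]
    refine key v u hv hu (by rwa [union_comm]) hnv hnu fun x hx => ?_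
    rcases huv ⟨hVU hx.1, hx.2⟩ with h | h
    · exact absurd ⟨x, hx, h⟩ h1
    · exact h

lemma IsPreconnected.union_chain {A B C D : Set ℂ} (hA : IsPreconnected A)
    (hB : IsPreconnected B) (hC : IsPreconnected C) (hD : IsPreconnected D)
    (hAB : (A ∩ B).Nonempty) (hBC : (B ∩ C).Nonempty) (hCD : (C ∩ D).Nonempty) :
    IsPreconnected (A ∪ B ∪ C ∪ D) :=
  ((hA.union' hAB hB).union' (hBC.mono fun _ hx => ⟨Or.inr hx.1, hx.2⟩) hC).union'
    (hCD.mono fun _ hx => ⟨Or.inr hx.1, hx.2⟩) hD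

lemma convex_reProdIm {s t : Set ℝ} (hs : Convex ℝ s) (ht : Convex ℝ t) :
    Convex ℝ (s ×ℂ t) := by
  intro x hx y hy a b ha hb hab
  rw [mem_reProdIm] at *
  constructor
  · simpa using hs hx.1 hy.1 ha hb hab
  · simpa using ht hx.2 hy.2 ha hb hab

/-- An open rectangle minus a smaller concentric closed rectangle is preconnected. -/
lemma isPreconnected_rect_diff {a b c d ε : ℝ} (hab : a ≤ b) (hcd : c ≤ d) (hε : 0 < ε) :
    IsPreconnected ((Ioo (a - ε) (b + ε) ×ℂ Ioo (c - ε) (d + ε)) \ (Icc a b ×ℂ Icc c d)) := by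
  have h := IsPreconnected.union_chain
    (convex_reProdIm (convex_Ioo (a - ε) a) (convex_Ioo (c - ε) (d + ε))).isPreconnected
    (convex_reProdIm (convex_Ioo (a - ε) (b + ε)) (convex_Ioo d (d + ε))).isPreconnected
    (convex_reProdIm (convex_Ioo b (b + ε)) (convex_Ioo (c - ε) (d + ε))).isPreconnected
    (convex_reProdIm (convex_Ioo (a - ε) (b + ε)) (convex_Ioo (c - ε) c)).isPreconnected
    ⟨⟨a - ε / 2, d + ε / 2⟩, by constructor <;> constructor <;> constructor <;> simp <;> linarith⟩
    ⟨⟨b + ε / 2, d + ε / 2⟩, by constructor <;> constructor <;> constructor <;> simp <;> linarith⟩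
    ⟨⟨b + ε / 2, c - ε / 2⟩, by constructor <;> constructor <;> constructor <;> simp <;> linarith⟩
  convert h using 1
  ext z
  simp only [Set.mem_sdiff, mem_reProdIm, mem_union, mem_Ioo, mem_Icc]
  grind

/-- The closed rectangular ring is preconnected. -/
lemma isPreconnected_rect_ring {a b c d ε : ℝ} (hab : a ≤ b) (hcd : c ≤ d) (hε : 0 < ε) :
    IsPreconnected ((Icc (a - 2 * ε) (b + 2 * ε) ×ℂ Icc (c - 2 * ε) (d + 2 * ε)) \
      (Ioo (a - ε) (b + ε) ×ℂ Ioo (c - ε) (d + ε))) := by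
  have h := IsPreconnected.union_chain
    (convex_reProdIm (convex_Icc (a - 2 * ε) (a - ε))
      (convex_Icc (c - 2 * ε) (d + 2 * ε))).isPreconnected
    (convex_reProdIm (convex_Icc (a - 2 * ε) (b + 2 * ε))
      (convex_Icc (d + ε) (d + 2 * ε))).isPreconnected
    (convex_reProdIm (convex_Icc (b + ε) (b + 2 * ε))
      (convex_Icc (c - 2 * ε) (d + 2 * ε))).isPreconnected
    (convex_reProdIm (convex_Icc (a - 2 * ε) (b + 2 * ε))
      (convex_Icc (c - 2 * ε) (c - ε))).isPreconnected
    ⟨⟨a - ε, d + ε⟩, by constructor <;> constructor <;> constructor <;> simp <;> linarith⟩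
    ⟨⟨b + ε, d + ε⟩, by constructor <;> constructor <;> constructor <;> simp <;> linarith⟩
    ⟨⟨b + ε, c - ε⟩, by constructor <;> constructor <;> constructor <;> simp <;> linarith⟩
  convert h using 1
  ext z
  simp only [Set.mem_sdiff, mem_reProdIm, mem_union, mem_Ioo, mem_Icc]
  grind

lemma isCompact_rect (a b c d : ℝ) : IsCompact (Icc a b ×ℂ Icc c d) :=
  isCompact_Icc.reProdIm isCompact_Icc

lemma isOpen_rect (a b c d : ℝ) : IsOpen (Ioo a b ×ℂ Ioo c d) :=
  isOpen_Ioo.reProdIm isOpen_Ioo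

/-- Every neighbourhood of a closed rectangle contains a larger concentric closed rectangle. -/
lemma exists_rect_subset {U : Set ℂ} (hU : IsOpen U) {a b c d : ℝ} (hab : a ≤ b) (hcd : c ≤ d)
    (h : Icc a b ×ℂ Icc c d ⊆ U) :
    ∃ ε₀ > 0, ∀ ε ≤ ε₀, Icc (a - ε) (b + ε) ×ℂ Icc (c - ε) (d + ε) ⊆ U := by
  obtain ⟨δ, hδ, hsub⟩ := (isCompact_rect a b c d).exists_cthickening_subset_open hU h
  refine ⟨δ / 2, by positivity, fun ε hε z hz => hsub ?_⟩
  rw [mem_reProdIm, mem_Icc, mem_Icc] at hz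
  obtain ⟨⟨h1, h2⟩, h3, h4⟩ := hz
  have hw : (⟨max a (min z.re b), max c (min z.im d)⟩ : ℂ) ∈ Icc a b ×ℂ Icc c d := by
    rw [mem_reProdIm]
    exact ⟨⟨le_max_left _ _, max_le hab (min_le_right _ _)⟩,
      ⟨le_max_left _ _, max_le hcd (min_le_right _ _)⟩⟩
  refine mem_cthickening_of_dist_le z _ δ _ hw ?_
  rw [dist_eq_norm]
  refine (norm_le_abs_re_add_abs_im _).trans ?_
  have e1 : |z.re - max a (min z.re b)| ≤ δ / 2 := by
    rw [abs_le]; constructor <;> rcases max_cases a (min z.re b) with h | h <;>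
      rcases min_cases z.re b with h' | h' <;> linarith
  have e2 : |z.im - max c (min z.im d)| ≤ δ / 2 := by
    rw [abs_le]; constructor <;> rcases max_cases c (min z.im d) with h | h <;>
      rcases min_cases z.im d with h' | h' <;> linarith
  simpa using (add_le_add e1 e2).trans (by linarith)

lemma IsPreconnected.diff_rect {U : Set ℂ} (hU : IsPreconnected U) (hUo : IsOpen U)
    {a b c d : ℝ} (hab : a ≤ b) (hcd : c ≤ d) (h : Icc a b ×ℂ Icc c d ⊆ U) :
    IsPreconnected (U \ (Icc a b ×ℂ Icc c d)) := by
  obtain ⟨ε, hε, hsub⟩ := exists_rect_subset hUo hab hcd h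
  refine hU.diff_of_nhd hUo (V := Ioo (a - ε) (b + ε) ×ℂ Ioo (c - ε) (d + ε)) (isOpen_rect _ _ _ _)
    (fun z hz => hsub ε le_rfl ?_) (fun z hz => ?_) (isCompact_rect _ _ _ _).isClosed
    (isPreconnected_rect_diff hab hcd hε)
  · exact ⟨Ioo_subset_Icc_self hz.1, Ioo_subset_Icc_self hz.2⟩
  · exact ⟨⟨by linarith [hz.1.1], by linarith [hz.1.2]⟩,
      ⟨by linarith [hz.2.1], by linarith [hz.2.2]⟩⟩

/-- Removing finitely many disjoint closed rectangles. -/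
lemma IsPreconnected.diff_iUnion_rect {ι : Type*} [Finite ι] {U : Set ℂ} (hU : IsPreconnected U)
    (hUo : IsOpen U) {Q : ι → Set ℂ}
    (hQ : ∀ j, ∃ a b c d : ℝ, a ≤ b ∧ c ≤ d ∧ Q j = Icc a b ×ℂ Icc c d)
    (hdisj : Pairwise fun i j => Disjoint (Q i) (Q j))
    (hQU : ∀ j, Q j ⊆ U ∨ Disjoint (Q j) U) : IsPreconnected (U \ ⋃ j, Q j) := by
  classical
  cases nonempty_fintype ι
  have key : ∀ s : Finset ι, IsPreconnected (U \ ⋃ j ∈ s, Q j) := by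
    intro s
    induction s using Finset.induction_on with
    | empty => simpa using hU
    | insert i s his ih =>
      have hcl : IsClosed (⋃ j ∈ s, Q j) := by
        refine s.finite_toSet.isClosed_biUnion fun j _ => ?_
        obtain ⟨a, b, c, d, -, -, h⟩ := hQ j
        rw [h]; exact (isCompact_rect _ _ _ _).isClosed
      have e : U \ ⋃ j ∈ insert i s, Q j = (U \ ⋃ j ∈ s, Q j) \ Q i := by
        rw [Finset.set_biUnion_insert, sdiff_sdiff, union_comm]
      rw [e]
      rcases hQU i with h | h
      · obtain ⟨a, b, c, d, hab, hcd, hi⟩ := hQ i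
        rw [hi]
        refine ih.diff_rect (hUo.sdiff hcl) hab hcd ?_
        rw [← hi]
        intro z hz
        refine ⟨h hz, ?_⟩
        simp only [mem_iUnion, not_exists]
        intro j hj hzj
        exact (hdisj (show i ≠ j from fun e => his (e ▸ hj))).le_bot ⟨hz, hzj⟩
      · rwa [sdiff_eq_left.2 (h.symm.mono_left sdiff_subset)]
  simpa using key Finset.univ

/-- A continuous function whose values are integers is constant on preconnected sets. -/
lemma IsPreconnected.eq_of_forall_int {X : Type*} [TopologicalSpace X] {S : Set X}
    (hS : IsPreconnected S) {v : X → ℂ} (hv : ContinuousOn v S)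
    (hval : ∀ x ∈ S, ∃ n : ℤ, v x = n) {x y : X} (hx : x ∈ S) (hy : y ∈ S) : v x = v y := by
  have hpre := hS.image v hv
  have hsub : (v '' S).Subsingleton := by
    have hc : (v '' S) ⊆ range (fun n : ℤ => (n : ℂ)) := by
      rintro _ ⟨x, hx, rfl⟩
      obtain ⟨n, hn⟩ := hval x hx
      exact ⟨n, hn.symm⟩
    have hcount : (v '' S).Countable := (countable_range _).mono hc
    exact hcount.isTotallyDisconnected _ subset_rfl hpre
  exact hsub ⟨x, hx, rfl⟩ ⟨y, hy, rfl⟩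

/-- `z ↦ z - a` has no continuous logarithm on a circle around `a`. -/
lemma not_exists_log_on_circle {a : ℂ} {R : ℝ} (hR : 0 < R) {M : ℂ → ℂ} (hM : Continuous M)
    (h : ∀ z, ‖z - a‖ = R → exp (M z) = z - a) : False := by
  let v : ℝ → ℂ := fun θ =>
    (M (a + exp (Real.log R + θ * I)) - Real.log R - θ * I) / (2 * Real.pi * I)
  have hv : Continuous v := by fun_prop
  have e : v 0 = v (2 * Real.pi) := by
    refine isPreconnected_univ.eq_of_forall_int hv.continuousOn (fun θ _ => ?_)
      (mem_univ _) (mem_univ _)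
    have h1 : ‖a + exp (Real.log R + θ * I) - a‖ = R := by
      rw [add_sub_cancel_left, norm_exp]
      simp [Real.exp_log hR]
    have h2 := h _ h1
    rw [add_sub_cancel_left, exp_eq_exp_iff_exists_int] at h2
    obtain ⟨n, hn⟩ := h2
    refine ⟨n, ?_⟩
    simp only [v]
    rw [hn]
    field_simp
    ring
  simp only [v] at e
  have e2 : exp (Real.log R + ((2 * Real.pi : ℝ) : ℂ) * I) =
      exp (Real.log R + ((0 : ℝ) : ℂ) * I) := by
    rw [exp_eq_exp_iff_exists_int]; exact ⟨1, by push_cast; ring⟩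
  rw [e2] at e
  have hpi : (2 * Real.pi * I : ℂ) ≠ 0 := by simp [Real.pi_ne_zero]
  rw [div_left_inj' hpi] at e
  push_cast at e
  have : (2 * Real.pi * I : ℂ) = 0 := by linear_combination e
  exact hpi this

lemma isSimplyConnected_univ_complex : IsSimplyConnected (univ : Set ℂ) := by
  have : ContractibleSpace (univ : Set ℂ) := (convex_univ).contractibleSpace univ_nonempty
  show SimplyConnectedSpace (univ : Set ℂ)
  infer_instance

/-- The complement of a simply connected plane domain has no bounded relatively clopen part. -/
lemma eq_empty_of_isSimplyConnected {Ω E E' : Set ℂ} (hΩ : IsSimplyConnected Ω) (hΩo : IsOpen Ω)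
    (hE : IsCompact E) (hE' : IsClosed E') (hdisj : Disjoint E E') (hcov : Ωᶜ = E ∪ E') :
    E = ∅ := by
  classical
  by_contra hne
  obtain ⟨a, ha⟩ := nonempty_iff_ne_empty.2 hne
  have haΩ : a ∉ Ω := by have : a ∈ Ωᶜ := hcov ▸ Or.inl ha
                         exact this
  obtain ⟨L, hLc, hL⟩ := exists_continuousOn_eqOn_exp_comp hΩ hΩo
    (g := fun z => z - a) (by fun_prop) (by
      rintro ⟨z, hz, h0⟩; rw [sub_eq_zero] at h0; exact haΩ (h0 ▸ hz))
  obtain ⟨d, hd, hdd⟩ := hdisj.exists_thickenings hE hE'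
  have hdE : ∀ z ∈ E', d ≤ infDist z E := by
    intro z hz
    by_contra hlt
    push Not at hlt
    have h1 : z ∈ thickening d E := (mem_thickening_iff_infDist_lt ⟨a, ha⟩).2 hlt
    exact hdd.le_bot ⟨h1, self_subset_thickening hd _ hz⟩
  let φ : ℂ → ℝ := fun z => max 0 (min 1 (2 - 3 * (infDist z E / d)))
  have hφ : Continuous φ := by
    have := continuous_infDist_pt E
    fun_prop
  have hφ1 : ∀ z, infDist z E < d / 3 → φ z = 1 := by
    intro z hz
    have : infDist z E / d < 1 / 3 := by rw [div_lt_iff₀ hd]; linarith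
    simp only [φ]
    rw [min_eq_left (by linarith)]; norm_num
  have hφ0 : ∀ z, 2 * d / 3 < infDist z E → φ z = 0 := by
    intro z hz
    have : 2 / 3 < infDist z E / d := by rw [lt_div_iff₀ hd]; linarith
    simp only [φ]
    exact max_eq_left ((min_le_right _ _).trans (by linarith))
  let H : ℂ → ℂ := fun z => if z ∈ Ω then exp ((1 - φ z) * L z) else if z ∈ E then 1 else z - a
  have hnotin : ∀ z, z ∉ Ω → z ∉ E → z ∈ E' := by
    intro z hz hzE
    have : z ∈ E ∪ E' := hcov ▸ hz
    exact this.resolve_left hzE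
  have hnear : ∀ z, infDist z E < d / 3 → H z = 1 := by
    intro z hz
    simp only [H]
    split_ifs with h1 h2
    · rw [hφ1 z hz]; simp
    · rfl
    · have := hdE z (hnotin z h1 h2); linarith
  have hfar : ∀ z, 2 * d / 3 < infDist z E → H z = z - a := by
    intro z hz
    simp only [H]
    split_ifs with h1 h2
    · rw [hφ0 z hz]; simpa using hL h1
    · rw [infDist_zero_of_mem h2] at hz; linarith
    · rfl
  have hH : Continuous H := by
    rw [continuous_iff_continuousAt]
    intro z
    by_cases hz : z ∈ Ω
    · have h1 : ContinuousAt (fun z => exp ((1 - φ z) * L z)) z := by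
        have := hLc.continuousAt (hΩo.mem_nhds hz)
        have := hφ.continuousAt (x := z)
        fun_prop
      refine h1.congr ?_
      filter_upwards [hΩo.mem_nhds hz] with w hw
      simp [H, hw]
    · by_cases hzE : z ∈ E
      · refine (continuousAt_const (y := (1 : ℂ))).congr ?_
        have : ∀ᶠ w in 𝓝 z, infDist w E < d / 3 :=
          (continuous_infDist_pt E).continuousAt.eventually_lt continuousAt_const
            (by rw [infDist_zero_of_mem hzE]; positivity)
        filter_upwards [this] with w hw using (hnear w hw).symm
      · refine (show ContinuousAt (fun w => w - a) z by fun_prop).congr ?_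
        have : ∀ᶠ w in 𝓝 z, 2 * d / 3 < infDist w E :=
          continuousAt_const.eventually_lt (continuous_infDist_pt E).continuousAt
            (by have := hdE z (hnotin z hz hzE); linarith)
        filter_upwards [this] with w hw using (hfar w hw).symm
  have hH0 : ∀ z, H z ≠ 0 := by
    intro z
    simp only [H]
    split_ifs with h1 h2
    · exact exp_ne_zero _
    · exact one_ne_zero
    · intro h0; rw [sub_eq_zero] at h0; exact h2 (h0 ▸ ha)
  have hsc : IsSimplyConnected (univ : Set ℂ) := isSimplyConnected_univ_complex
  obtain ⟨M, hMc, hM⟩ := exists_continuousOn_eqOn_exp_comp hsc isOpen_univ hH.continuousOn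
    (by rintro ⟨z, -, h0⟩; exact hH0 z h0)
  obtain ⟨R, hR⟩ := hE.isBounded.subset_closedBall a
  have hRpos : 0 < |R| + d := by positivity
  refine not_exists_log_on_circle (a := a) (M := M) hRpos (continuousOn_univ.1 hMc) fun z hz => ?_
  have h1 : exp (M z) = H z := hM (mem_univ z)
  rw [h1]
  apply hfar
  have : d ≤ infDist z E := by
    rw [le_infDist ⟨a, ha⟩]
    intro y hy
    have h2 := hR hy
    rw [mem_closedBall] at h2
    have h3 : dist z a ≤ dist z y + dist y a := dist_triangle _ _ _
    rw [dist_eq_norm z a, hz] at h3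
    linarith [le_abs_self R]
  linarith

/-- In a plane domain with connected complement, a connected compact set `K` does not separate two
components of `Ω \ K` both reaching the boundary of `Ω`. -/
lemma connectedComponentIn_eq_of_closure_meets {Ω K : Set ℂ} (hΩo : IsOpen Ω)
    (hΩ : IsPreconnected Ω) (hP : IsPreconnected Ωᶜ) (hKc : IsClosed K) (hK : IsPreconnected K)
    (hKΩ : K ⊆ Ω) (hKn : K.Nonempty) {x y : ℂ} (hx : x ∈ Ω \ K) (hy : y ∈ Ω \ K)
    (hxP : (closure (connectedComponentIn (Ω \ K) x) ∩ Ωᶜ).Nonempty)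
    (hyP : (closure (connectedComponentIn (Ω \ K) y) ∩ Ωᶜ).Nonempty) :
    y ∈ connectedComponentIn (Ω \ K) x := by
  by_contra hyx
  set A := connectedComponentIn (Ω \ K) x with hA
  have hUo : IsOpen (Ω \ K) := hΩo.sdiff hKc
  have hAo : IsOpen A := hUo.connectedComponentIn
  have hAsub : A ⊆ Ω \ K := connectedComponentIn_subset _ _
  have hxA : x ∈ A := mem_connectedComponentIn hx
  -- closures of components stay away from the other components
  have hclA : closure A ∩ (Ω \ K) ⊆ A := by
    rintro z ⟨hz, hzU⟩
    have ho : IsOpen (connectedComponentIn (Ω \ K) z) := hUo.connectedComponentIn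
    obtain ⟨w, hw, hwA⟩ := mem_closure_iff.1 hz _ ho (mem_connectedComponentIn hzU)
    rw [hA, connectedComponentIn_eq hwA, ← connectedComponentIn_eq hw]
    exact mem_connectedComponentIn hzU
  have hclK : ∀ z ∈ Ω \ K, (closure (connectedComponentIn (Ω \ K) z) ∩ K).Nonempty := by
    intro z hz
    by_contra hem
    rw [not_nonempty_iff_eq_empty] at hem
    have hcl : closure (connectedComponentIn (Ω \ K) z) ∩ Ω ⊆ connectedComponentIn (Ω \ K) z := by
      rintro w ⟨hw, hwΩ⟩
      have hwK : w ∉ K := fun h => by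
        have : w ∈ closure (connectedComponentIn (Ω \ K) z) ∩ K := ⟨hw, h⟩
        rw [hem] at this; exact this
      have ho : IsOpen (connectedComponentIn (Ω \ K) w) := hUo.connectedComponentIn
      obtain ⟨v, hv, hvA⟩ := mem_closure_iff.1 hw _ ho (mem_connectedComponentIn ⟨hwΩ, hwK⟩)
      rw [connectedComponentIn_eq hvA, ← connectedComponentIn_eq hv]
      exact mem_connectedComponentIn ⟨hwΩ, hwK⟩
    obtain ⟨k, hk⟩ := hKn
    have ho : IsOpen (connectedComponentIn (Ω \ K) z) := hUo.connectedComponentIn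
    have hsubset : Ω ⊆ connectedComponentIn (Ω \ K) z := by
      refine hΩ.subset_of_closure_inter_subset ho ⟨z, hz.1, mem_connectedComponentIn hz⟩ hcl
    exact (connectedComponentIn_subset _ _ (hsubset (hKΩ hk))).2 hk
  have hdPK : Disjoint Ωᶜ K := Set.disjoint_left.2 fun z hz hzK => hz (hKΩ hzK)
  obtain ⟨u, hu0, hu1, -⟩ := exists_continuous_zero_one_of_isClosed hΩo.isClosed_compl hKc hdPK
  classical
  let f : ℂ → ℂ := fun z => if z ∈ A then exp (2 * Real.pi * I * u z) else 1
  have hf : Continuous f := by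
    have h1 : Continuous fun z : ℂ => exp (2 * Real.pi * I * (u z : ℂ)) := by
      have := u.continuous
      fun_prop
    refine Continuous.if ?_ h1 continuous_const
    intro z hz
    have hz1 : z ∈ closure A := frontier_subset_closure hz
    have hz2 : z ∉ A := fun h => by
      have := hz.2; rw [show {x | x ∈ A} = A from rfl, hAo.interior_eq] at this; exact this h
    by_cases hzΩ : z ∈ Ω
    · have hzK : z ∈ K := by
        by_contra hzK; exact hz2 (hclA ⟨hz1, hzΩ, hzK⟩)
      have : u z = 1 := hu1 hzK
      rw [this]; simp
    · have : u z = 0 := hu0 hzΩ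
      rw [this]; simp
  have hf0 : ∀ z, f z ≠ 0 := by
    intro z; simp only [f]; split_ifs
    exacts [exp_ne_zero _, one_ne_zero]
  obtain ⟨M, hMc, hM⟩ := exists_continuousOn_eqOn_exp_comp isSimplyConnected_univ_complex
    isOpen_univ hf.continuousOn (by rintro ⟨z, -, h0⟩; exact hf0 z h0)
  have hMc' : Continuous M := continuousOn_univ.1 hMc
  let v : ℂ → ℂ := fun z => M z / (2 * Real.pi * I)
  have hv : Continuous v := by fun_prop
  have hpi : (2 * Real.pi * I : ℂ) ≠ 0 := by simp [Real.pi_ne_zero]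
  have hvint : ∀ z ∉ A, ∃ n : ℤ, v z = n := by
    intro z hz
    have h1 : exp (M z) = 1 := by
      have := hM (mem_univ z); simpa [f, hz] using this
    obtain ⟨n, hn⟩ := exp_eq_one_iff.1 h1
    exact ⟨n, by simp only [v]; rw [hn]; field_simp⟩
  have hvA : ∀ z ∈ A, ∃ n : ℤ, v z - u z = n := by
    intro z hz
    have h1 : exp (M z) = exp (2 * Real.pi * I * u z) := by
      have := hM (mem_univ z); simpa [f, hz] using this
    obtain ⟨n, hn⟩ := exp_eq_exp_iff_exists_int.1 h1
    exact ⟨n, by simp only [v]; rw [hn]; field_simp; ring⟩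
  have huint : ∀ z ∉ Ω \ K, ∃ n : ℤ, (u z : ℂ) = n := by
    intro z hz
    by_cases hzΩ : z ∈ Ω
    · have hzK : z ∈ K := by by_contra h; exact hz ⟨hzΩ, h⟩
      exact ⟨1, by rw [show u z = 1 from hu1 hzK]; simp⟩
    · exact ⟨0, by rw [show u z = 0 from hu0 hzΩ]; simp⟩
  obtain ⟨p, hpA, hpP⟩ := hxP
  obtain ⟨q, hqB, hqP⟩ := hyP
  obtain ⟨k, hkA, hkK⟩ := hclK x hx
  obtain ⟨l, hlB, hlK⟩ := hclK y hy
  have hPA : ∀ z ∈ Ωᶜ, z ∉ A := fun z hz h => hz (hAsub h).1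
  have hKA : ∀ z ∈ K, z ∉ A := fun z hz h => (hAsub h).2 hz
  have e1 : v p = v q :=
    hP.eq_of_forall_int hv.continuousOn (fun z hz => hvint z (hPA z hz)) hpP hqP
  have e2 : v k = v l :=
    hK.eq_of_forall_int hv.continuousOn (fun z hz => hvint z (hKA z hz)) hkK hlK
  have hBA : Disjoint (closure (connectedComponentIn (Ω \ K) y)) A := by
    refine Disjoint.closure_left (Set.disjoint_left.2 fun z hz hzA => hyx ?_) hAo
    rw [hA, connectedComponentIn_eq hzA, ← connectedComponentIn_eq hz]
    exact mem_connectedComponentIn hy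
  have e3 : v q = v l := isPreconnected_connectedComponentIn.closure.eq_of_forall_int
    hv.continuousOn (fun z hz => hvint z (Set.disjoint_left.1 hBA hz)) hqB hlB
  have e4 : v p - u p = v k - u k := by
    refine isPreconnected_connectedComponentIn.closure.eq_of_forall_int
      (v := fun z => v z - u z) ?_ (fun z hz => ?_) hpA hkA
    · have := u.continuous
      fun_prop
    · by_cases hzA : z ∈ A
      · exact hvA z hzA
      · obtain ⟨n, hn⟩ := hvint z hzA
        obtain ⟨m, hm⟩ := huint z fun h => hzA (hclA ⟨hz, h⟩)
        exact ⟨n - m, by rw [hn, hm]; push_cast; ring⟩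
  rw [show u p = 0 from hu0 hpP, show u k = 1 from hu1 hkK] at e4
  rw [e1, e3, ← e2] at e4
  have : (1 : ℂ) = 0 := by push_cast at e4; linear_combination e4
  exact one_ne_zero this

lemma isOpen_UHP : IsOpen UHP := isOpen_lt continuous_const continuous_im

lemma isOpen_hull_compl {F : Set ℂ} (hF : IsHHull F) : IsOpen (UHP \ F) := by
  have : UHP \ F = UHP \ closure F := by
    ext z
    exact ⟨fun h => ⟨h.1, fun h2 => h.2 (hF.2.1 ⟨h2, h.1⟩)⟩,
      fun h => ⟨h.1, fun h2 => h.2 (subset_closure h2)⟩⟩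
  rw [this]
  exact isOpen_UHP.sdiff isClosed_closure

/-- The complement of a hull complement is connected. -/
lemma isPreconnected_compl_hull {F : Set ℂ} (hF : IsHHull F) (hb : IsBounded F) :
    IsPreconnected (UHP \ F)ᶜ := by
  have hΩo : IsOpen (UHP \ F) := isOpen_hull_compl hF
  have key : ∀ u v : Set ℂ, IsClosed u → IsClosed v → (UHP \ F)ᶜ ⊆ u ∪ v →
      (UHP \ F)ᶜ ∩ (u ∩ v) = ∅ → {z : ℂ | z.im ≤ 0} ⊆ v → (UHP \ F)ᶜ ⊆ v := by
    intro u v hu hv hcov hdis hH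
    have hE : (UHP \ F)ᶜ ∩ u ⊆ F := by
      rintro z ⟨hz, hzu⟩
      by_contra hzF
      have hz0 : z.im ≤ 0 := by
        by_contra h
        exact hz ⟨not_le.1 h, hzF⟩
      have : z ∈ (UHP \ F)ᶜ ∩ (u ∩ v) := ⟨hz, hzu, hH hz0⟩
      rw [hdis] at this; exact this
    have hEc : IsCompact ((UHP \ F)ᶜ ∩ u) :=
      isCompact_of_isClosed_isBounded (hΩo.isClosed_compl.inter hu) (hb.subset hE)
    have hem := eq_empty_of_isSimplyConnected (Ω := UHP \ F) hF.2.2.2 hΩo hEc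
      (hΩo.isClosed_compl.inter hv)
      (Set.disjoint_left.2 fun z h1 h2 => by
        have : z ∈ (UHP \ F)ᶜ ∩ (u ∩ v) := ⟨h1.1, h1.2, h2.2⟩
        rw [hdis] at this; exact this)
      (by rw [← inter_union_distrib_left]; exact (inter_eq_left.2 hcov).symm)
    intro z hz
    rcases hcov hz with h | h
    · have : z ∈ (UHP \ F)ᶜ ∩ u := ⟨hz, h⟩
      rw [hem] at this; exact this.elim
    · exact h
  have hlow : {z : ℂ | z.im ≤ 0} ⊆ (UHP \ F)ᶜ :=
    fun z (hz : z.im ≤ 0) h => not_lt.2 hz (show 0 < z.im from h.1)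
  have hpre : IsPreconnected {z : ℂ | z.im ≤ 0} := (convex_halfSpace_im_le 0).isPreconnected
  rw [isPreconnected_iff_subset_of_disjoint_closed]
  intro u v hu hv hcov hdis
  rcases isPreconnected_iff_subset_of_disjoint_closed.1 hpre u v hu hv (hlow.trans hcov)
    (subset_empty_iff.1 ((inter_subset_inter_left _ hlow).trans hdis.subset)) with h | h
  · exact Or.inl (key v u hv hu (by rwa [union_comm]) (by rwa [inter_comm v u]) h)
  · exact Or.inr (key u v hu hv hcov hdis h)

lemma IsHorizontalSlit.exists_rect {C : Set ℂ} (h : IsHorizontalSlit C) :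
    ∃ a b y : ℝ, 0 < y ∧ a < b ∧ C = Icc a b ×ℂ Icc y y := by
  obtain ⟨y, a, b, hy, hab, rfl⟩ := h
  refine ⟨a, b, y, hy, hab, ?_⟩
  ext z
  simp only [mem_ofPred_eq, mem_reProdIm, Icc_self, mem_singleton_iff]
  tauto

lemma IsHorizontalSlit.isCompact {C : Set ℂ} (h : IsHorizontalSlit C) : IsCompact C := by
  obtain ⟨a, b, y, -, -, rfl⟩ := h.exists_rect
  exact isCompact_rect _ _ _ _

lemma IsHorizontalSlit.subset_UHP {C : Set ℂ} (h : IsHorizontalSlit C) : C ⊆ UHP := by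
  obtain ⟨y, a, b, hy, -, rfl⟩ := h
  intro z hz
  show 0 < z.im
  rw [hz.1]; exact hy

lemma isCompact_iUnion_slit {N : ℕ} {C : Fin N → Set ℂ} (h : ∀ j, IsHorizontalSlit (C j)) :
    IsCompact (⋃ j, C j) := isCompact_iUnion fun j => (h j).isCompact

/-- The complement in a domain of finitely many disjoint slits is preconnected. -/
lemma IsPreconnected.diff_slits {N : ℕ} {C : Fin N → Set ℂ} {U : Set ℂ} (hU : IsPreconnected U)
    (hUo : IsOpen U) (h : ∀ j, IsHorizontalSlit (C j))
    (hd : Pairwise fun i j => Disjoint (C i) (C j)) (hs : ∀ j, C j ⊆ U ∨ Disjoint (C j) U) :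
    IsPreconnected (U \ ⋃ j, C j) := by
  refine hU.diff_iUnion_rect hUo (fun j => ?_) hd hs
  obtain ⟨a, b, y, -, hab, e⟩ := (h j).exists_rect
  exact ⟨a, b, y, y, hab.le, le_rfl, e⟩

lemma IsParallelSlitHalfPlane.isOpen {D : Set ℂ} (h : IsParallelSlitHalfPlane D) : IsOpen D := by
  obtain ⟨N, C, hC, -, rfl⟩ := h
  exact isOpen_UHP.sdiff (isCompact_iUnion_slit hC).isClosed

lemma IsParallelSlitHalfPlane.subset_UHP {D : Set ℂ} (h : IsParallelSlitHalfPlane D) :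
    D ⊆ UHP := by
  obtain ⟨N, C, hC, -, rfl⟩ := h
  exact sdiff_subset

lemma IsParallelSlitHalfPlane.im_pos {D : Set ℂ} (h : IsParallelSlitHalfPlane D) {w : ℂ}
    (hw : w ∈ D) : 0 < w.im := h.subset_UHP hw

/-- The finite set of heights of boundary points. -/
lemma IsParallelSlitHalfPlane.exists_heights {D : Set ℂ} (h : IsParallelSlitHalfPlane D) :
    ∃ Y : Set ℝ, Y.Finite ∧ 0 ∈ Y ∧ ∀ w ∉ D, 0 ≤ w.im → w.im ∈ Y := by
  obtain ⟨N, C, hC, -, rfl⟩ := h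
  choose y a b hy hab e using hC
  refine ⟨insert 0 (range y), (finite_range y).insert 0, mem_insert _ _, fun w hw hw0 => ?_⟩
  rcases hw0.eq_or_lt with h0 | h0
  · rw [← h0]; exact mem_insert _ _
  · have : w ∈ ⋃ j, C j := by
      by_contra hn
      exact hw ⟨h0, hn⟩
    obtain ⟨j, hj⟩ := mem_iUnion.1 this
    rw [e j] at hj
    rw [hj.1]
    exact mem_insert_of_mem _ (mem_range_self j)

lemma IsParallelSlitHalfPlane.exists_far {D : Set ℂ} (h : IsParallelSlitHalfPlane D) :
    ∃ R : ℝ, ∀ w : ℂ, 0 < w.im → R < ‖w‖ → w ∈ D := by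
  obtain ⟨N, C, hC, -, rfl⟩ := h
  obtain ⟨R, hR⟩ := (isCompact_iUnion_slit hC).isBounded.exists_norm_le
  exact ⟨R, fun w h1 h2 => ⟨h1, fun h3 => not_lt.2 (hR w h3) h2⟩⟩

/-- Outer half-annuli are connected. -/
lemma isPreconnected_half_annulus {R : ℝ} (hR : 0 ≤ R) :
    IsPreconnected {w : ℂ | 0 < w.im ∧ R < ‖w‖} := by
  have h1 : IsPreconnected (Ioi R ×ˢ Ioo 0 Real.pi) := isPreconnected_Ioi.prod isPreconnected_Ioo
  have h2 := h1.image (fun p : ℝ × ℝ => (p.1 : ℂ) * exp (p.2 * I)) (by fun_prop)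
  convert h2 using 1
  ext w
  constructor
  · rintro ⟨hw, hRw⟩
    refine ⟨(‖w‖, arg w), ⟨hRw, ?_, ?_⟩, norm_mul_exp_arg_mul_I w⟩
    · rcases (arg_nonneg_iff.2 hw.le).eq_or_lt with h | h
      · exact absurd (arg_eq_zero_iff.1 h.symm).2 hw.ne'
      · exact h
    · exact (arg_lt_pi_iff.2 (Or.inr hw.ne'))
  · rintro ⟨⟨r, θ⟩, ⟨hr, h0, hpi⟩, rfl⟩
    have hr' : R < r := hr
    have hr0 : 0 < r := hR.trans_lt hr'
    constructor
    · simp only [exp_mul_I, mul_im, ofReal_re, ofReal_im, zero_mul, add_zero, add_im, I_re, I_im]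
      have : 0 < Real.sin θ := Real.sin_pos_of_pos_of_lt_pi h0 hpi
      simp [← ofReal_sin, ← ofReal_cos]
      positivity
    · simpa [norm_exp_ofReal_mul_I, abs_of_pos hr0] using hr'

lemma isOpen_image_of_injOn {G : Set ℂ} {g : ℂ → ℂ}
    (hg : DifferentiableOn ℂ g G) (hi : InjOn g G) {V : Set ℂ} (hV : IsOpen V) (hVG : V ⊆ G) :
    IsOpen (g '' V) := by
  rw [isOpen_iff_forall_mem_open]
  rintro _ ⟨z, hz, rfl⟩
  obtain ⟨r, hr, hrV⟩ := Metric.isOpen_iff.1 hV z hz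
  have han : AnalyticOnNhd ℂ g (ball z r) :=
    (hg.mono (hrV.trans hVG)).analyticOnNhd isOpen_ball
  rcases han.is_constant_or_isOpen (convex_ball z r).isPreconnected with ⟨w, hw⟩ | h
  · exfalso
    have h1 : z + (r / 2 : ℝ) ∈ ball z r := by
      simp [abs_of_pos hr]; linarith
    have h2 : z ∈ ball z r := mem_ball_self hr
    have := hi (hVG (hrV h1)) (hVG (hrV h2)) ((hw _ h1).trans (hw _ h2).symm)
    have : ((r / 2 : ℝ) : ℂ) = 0 := by linear_combination this
    rw [ofReal_eq_zero] at this
    linarith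
  · exact ⟨g '' ball z r, image_mono hrV, h _ subset_rfl isOpen_ball,
      mem_image_of_mem _ (mem_ball_self hr)⟩

lemma continuousOn_inverse {G D : Set ℂ} {g k : ℂ → ℂ} (hG : IsOpen G)
    (hg : DifferentiableOn ℂ g G) (hi : InjOn g G) (hkm : MapsTo k D G)
    (hgk : ∀ w ∈ D, g (k w) = w) : ContinuousOn k D := by
  intro w hw
  rw [ContinuousWithinAt, _root_.tendsto_nhds]
  intro V hV hVw
  have ho := isOpen_image_of_injOn hg hi (hV.inter hG) inter_subset_right
  have hwm : w ∈ g '' (V ∩ G) := ⟨k w, ⟨hVw, hkm hw⟩, hgk w hw⟩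
  filter_upwards [mem_nhdsWithin_of_mem_nhds (ho.mem_nhds hwm), self_mem_nhdsWithin] with u hu huD
  obtain ⟨z, ⟨hzV, hzG⟩, rfl⟩ := hu
  have : k (g z) = z := hi (hkm huD) hzG (hgk _ huD)
  show k (g z) ∈ V
  rwa [this]

/-- The inverse of an injective holomorphic map is holomorphic. -/
lemma differentiableOn_inverse_of_injOn {G D : Set ℂ} {g k : ℂ → ℂ} (hG : IsOpen G) (hD : IsOpen D)
    (hg : DifferentiableOn ℂ g G) (hi : InjOn g G) (hkm : MapsTo k D G)
    (hgk : ∀ w ∈ D, g (k w) = w) : DifferentiableOn ℂ k D := by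
  have hkc := continuousOn_inverse hG hg hi hkm hgk
  intro w hw
  have hkw := hkm hw
  have hkat : ContinuousAt k w := hkc.continuousAt (hD.mem_nhds hw)
  refine (analyticAt_of_differentiable_on_punctured_nhds_of_continuousAt ?_ hkat
    ).differentiableAt.differentiableWithinAt
  have han : AnalyticAt ℂ (deriv g) (k w) :=
    (hg.analyticOnNhd hG).deriv _ hkw
  have hne : ∀ᶠ z in 𝓝[≠] (k w), deriv g z ≠ 0 := by
    rcases han.eventually_eq_zero_or_eventually_ne_zero with h | h
    · exfalso
      obtain ⟨r, hr, hrs⟩ := Metric.eventually_nhds_iff_ball.1 (h.and (hG.mem_nhds hkw))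
      have h1 : k w + (r / 2 : ℝ) ∈ ball (k w) r := by
        simp [abs_of_pos hr]; linarith
      have hconst := (convex_ball (k w) r).is_const_of_fderivWithin_eq_zero (𝕜 := ℂ) (f := g)
        (hg.mono fun z hz => (hrs z hz).2) (fun z hz => by
          rw [fderivWithin_of_isOpen isOpen_ball hz]
          ext
          simpa using (hrs z hz).1) h1 (mem_ball_self hr)
      have := hi (hrs _ h1).2 hkw hconst
      have : ((r / 2 : ℝ) : ℂ) = 0 := by linear_combination this
      rw [ofReal_eq_zero] at this
      linarith
    · exact h
  have htend : Tendsto k (𝓝[≠] w) (𝓝[≠] (k w)) := by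
    refine tendsto_nhdsWithin_iff.2 ⟨hkat.mono_left nhdsWithin_le_nhds, ?_⟩
    filter_upwards [self_mem_nhdsWithin, mem_nhdsWithin_of_mem_nhds (hD.mem_nhds hw)] with u hu huD
    intro h
    exact hu (by rw [mem_singleton_iff, ← hgk u huD, ← hgk w hw, show k u = k w from h])
  filter_upwards [htend.eventually hne, mem_nhdsWithin_of_mem_nhds (hD.mem_nhds hw)] with u hu huD
  have hgd : HasDerivAt g (deriv g (k u)) (k u) :=
    (hg.differentiableAt (hG.mem_nhds (hkm huD))).hasDerivAt
  refine (HasDerivAt.of_local_left_inverse (hkc.continuousAt (hD.mem_nhds huD)) hgd hu ?_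
    ).differentiableAt
  filter_upwards [hD.mem_nhds huD] with v hv using hgk v hv

/-- The domain of a mapping-out function. -/
def outDom {N : ℕ} (C : Fin N → Set ℂ) (F : Set ℂ) : Set ℂ := (UHP \ ⋃ j, C j) \ F

/-- `g` is a mapping-out function of the hull `F`. -/
structure MapOut {N : ℕ} (C : Fin N → Set ℂ) (F D' : Set ℂ) (g : ℂ → ℂ) : Prop where
  slit : ∀ j, IsHorizontalSlit (C j)
  disj : Pairwise fun i j => Disjoint (C i) (C j)
  hull : IsHHull F
  bdd : IsBounded F
  cldisj : Disjoint (closure F) (⋃ j, C j)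
  target : IsParallelSlitHalfPlane D'
  diff : DifferentiableOn ℂ g (outDom C F)
  bij : BijOn g (outDom C F) D'
  norm : Tendsto (fun z => g z - z) (cobounded ℂ ⊓ 𝓟 (outDom C F)) (𝓝 0)

namespace MapOut

variable {N : ℕ} {C : Fin N → Set ℂ} {F D' : Set ℂ} {g : ℂ → ℂ}

lemma dom_eq : outDom C F = (UHP \ F) \ ⋃ j, C j := sdiff_right_comm _ _ _

lemma slits_subset (h : MapOut C F D' g) : (⋃ j, C j) ⊆ UHP \ F := fun _ hz =>
  ⟨iUnion_subset (fun j => (h.slit j).subset_UHP) hz,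
    fun hF => Set.disjoint_left.1 h.cldisj (subset_closure hF) hz⟩

lemma isOpen_dom (h : MapOut C F D' g) : IsOpen (outDom C F) := by
  rw [dom_eq]
  exact (isOpen_hull_compl h.hull).sdiff (isCompact_iUnion_slit h.slit).isClosed

lemma isPreconnected_dom (h : MapOut C F D' g) : IsPreconnected (outDom C F) := by
  rw [dom_eq]
  exact h.hull.2.2.1.isPreconnected.diff_slits (isOpen_hull_compl h.hull) h.slit h.disj
    fun j => Or.inl ((subset_iUnion _ j).trans h.slits_subset)

lemma im_pos (h : MapOut C F D' g) {z : ℂ} (hz : z ∈ outDom C F) : 0 < (g z).im :=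
  h.target.im_pos (h.bij.mapsTo hz)

lemma exists_far (h : MapOut C F D' g) :
    ∃ R : ℝ, ∀ z : ℂ, 0 < z.im → R < ‖z‖ → z ∈ outDom C F := by
  obtain ⟨R, hR⟩ := ((isCompact_iUnion_slit h.slit).isBounded.union h.bdd).exists_norm_le
  exact ⟨R, fun z h1 h2 => ⟨⟨h1, fun h3 => not_lt.2 (hR z (Or.inl h3)) h2⟩,
    fun h3 => not_lt.2 (hR z (Or.inr h3)) h2⟩⟩

lemma neBot (h : MapOut C F D' g) : (cobounded ℂ ⊓ 𝓟 (outDom C F)).NeBot := by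
  obtain ⟨R, hR⟩ := h.exists_far
  rw [inf_principal_neBot_iff]
  intro U hU
  obtain ⟨r, -, hr⟩ := (hasBasis_cobounded_norm (E := ℂ)).mem_iff.1 hU
  refine ⟨((max r R + 1) ⊔ 1 : ℝ) * I, hr ?_, hR _ ?_ ?_⟩
  · simp only [mem_ofPred_eq, norm_mul, norm_I, mul_one, norm_real, Real.norm_eq_abs]
    refine le_trans ?_ (le_abs_self _)
    exact le_trans (by linarith [le_max_left r R]) (le_max_left _ _)
  · simp
  · simp only [norm_mul, norm_I, mul_one, norm_real, Real.norm_eq_abs]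
    refine lt_of_lt_of_le ?_ (le_abs_self _)
    exact lt_of_lt_of_le (by linarith [le_max_right r R]) (le_max_left _ _)

lemma exists_inverse (h : MapOut C F D' g) : ∃ k : ℂ → ℂ, DifferentiableOn ℂ k D' ∧
    MapsTo k D' (outDom C F) ∧ (∀ w ∈ D', g (k w) = w) ∧ ∀ z ∈ outDom C F, k (g z) = z := by
  have hinv := h.bij.invOn_invFunOn
  have hm : MapsTo (Function.invFunOn g (outDom C F)) D' (outDom C F) :=
    h.bij.surjOn.mapsTo_invFunOn
  exact ⟨_, differentiableOn_inverse_of_injOn h.isOpen_dom h.target.isOpen h.diff h.bij.injOn hm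
    (fun w hw => hinv.2 hw), hm, fun w hw => hinv.2 hw, fun z hz => hinv.1 hz⟩

lemma exists_bound (h : MapOut C F D' g) : ∃ B : ℝ, ∀ z ∈ outDom C F, ‖g z - z‖ ≤ B := by
  obtain ⟨k, hkd, hkm, hgk, hkg⟩ := h.exists_inverse
  obtain ⟨R₀, hR₀⟩ := h.exists_far
  obtain ⟨R₁, hR₁⟩ := h.target.exists_far
  obtain ⟨R₂, hR₂⟩ : ∃ R₂ : ℝ, ∀ z ∈ outDom C F, R₂ < ‖z‖ → ‖g z - z‖ ≤ 1 := by
    have := h.norm.eventually (ball_mem_nhds (0 : ℂ) one_pos)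
    rw [eventually_inf_principal] at this
    obtain ⟨r, -, hr⟩ := (hasBasis_cobounded_norm (E := ℂ)).eventually_iff.1 this
    exact ⟨r, fun z hz hrz => by simpa using (hr hrz.le hz).le⟩
  set R := max (max R₀ R₁) (max R₂ 0) with hR
  have a0 : R₀ ≤ R := (le_max_left _ _).trans (le_max_left _ _)
  have a1 : R₁ ≤ R := (le_max_right _ _).trans (le_max_left _ _)
  have a2 : R₂ ≤ R := (le_max_left _ _).trans (le_max_right _ _)
  have a3 : 0 ≤ R := (le_max_right _ _).trans (le_max_right _ _)
  have hE : IsPreconnected {w : ℂ | 0 < w.im ∧ R + 3 < ‖w‖} :=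
    isPreconnected_half_annulus (by linarith)
  have hED : {w : ℂ | 0 < w.im ∧ R + 3 < ‖w‖} ⊆ D' := fun w hw => hR₁ w hw.1 (by linarith [hw.2])
  have him := hE.image (fun w => ‖k w‖) (hkd.continuousOn.mono hED).norm
  have hgap : ∀ w ∈ {w : ℂ | 0 < w.im ∧ R + 3 < ‖w‖}, R < ‖k w‖ → R + 2 < ‖k w‖ := by
    intro w hw hlt
    have h1 := hR₂ _ (hkm (hED hw)) (a2.trans_lt hlt)
    rw [hgk w (hED hw)] at h1
    have h2 := hw.2
    have h3 : ‖w‖ ≤ ‖w - k w‖ + ‖k w‖ := by simpa using norm_add_le (w - k w) (k w)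
    linarith
  have hz1n : ‖((R + 10 : ℝ) : ℂ) * I‖ = R + 10 := by
    rw [norm_mul, norm_I, mul_one, norm_real, Real.norm_eq_abs, abs_of_nonneg (by linarith)]
  have hz1 : ((R + 10 : ℝ) : ℂ) * I ∈ outDom C F := by
    apply hR₀
    · simp; linarith
    · rw [hz1n]; linarith
  have hz1E : g (((R + 10 : ℝ) : ℂ) * I) ∈ {w : ℂ | 0 < w.im ∧ R + 3 < ‖w‖} := by
    refine ⟨h.im_pos hz1, ?_⟩
    have h1 := hR₂ _ hz1 (by rw [hz1n]; linarith)
    have h3 := norm_sub_norm_le (((R + 10 : ℝ) : ℂ) * I) (g (((R + 10 : ℝ) : ℂ) * I))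
    rw [norm_sub_rev, hz1n] at h3
    linarith
  have hall : ∀ w ∈ {w : ℂ | 0 < w.im ∧ R + 3 < ‖w‖}, R < ‖k w‖ := by
    intro w hw
    by_contra hle
    push Not at hle
    have hmem := him.Icc_subset (mem_image_of_mem _ hw) (mem_image_of_mem _ hz1E)
      (show R + 1 ∈ Icc ‖k w‖ _ from ⟨by linarith, by
        show R + 1 ≤ ‖k (g _)‖
        rw [hkg _ hz1, hz1n]; linarith⟩)
    obtain ⟨u, hu, hu1⟩ := hmem
    have hu1' : ‖k u‖ = R + 1 := hu1
    have := hgap u hu (by linarith)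
    linarith
  refine ⟨2 * R + 3, fun z hz => ?_⟩
  by_cases hzR : R < ‖z‖
  · have := hR₂ z hz (a2.trans_lt hzR); linarith
  · have h1 : ‖g z‖ ≤ R + 3 := by
      by_contra hlt
      push Not at hlt
      have := hall (g z) ⟨h.im_pos hz, hlt⟩
      rw [hkg z hz] at this
      exact hzR this
    have := norm_sub_le (g z) z
    push Not at hzR
    linarith

lemma tendsto_not_mem_target (h : MapOut C F D' g) {u : ℕ → ℂ} {z w : ℂ}
    (hu : ∀ n, u n ∈ outDom C F) (huz : Tendsto u atTop (𝓝 z)) (hz : z ∉ outDom C F)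
    (hgw : Tendsto (fun n => g (u n)) atTop (𝓝 w)) : w ∉ D' := by
  intro hw
  obtain ⟨k, hkd, hkm, hgk, hkg⟩ := h.exists_inverse
  have hk : ContinuousAt k w := hkd.continuousOn.continuousAt (h.target.isOpen.mem_nhds hw)
  have h1 : Tendsto (fun n => k (g (u n))) atTop (𝓝 (k w)) := hk.tendsto.comp hgw
  have h2 : (fun n => k (g (u n))) = u := funext fun n => hkg _ (hu n)
  rw [h2] at h1
  exact hz (tendsto_nhds_unique huz h1 ▸ hkm hw)

lemma tendsto_not_mem_dom (h : MapOut C F D' g) {u : ℕ → ℂ} {z w : ℂ}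
    (huz : Tendsto u atTop (𝓝 z))
    (hgw : Tendsto (fun n => g (u n)) atTop (𝓝 w)) (hw : w ∉ D') : z ∉ outDom C F := by
  intro hz
  have h1 := ((h.diff.continuousOn.continuousAt (h.isOpen_dom.mem_nhds hz)).tendsto).comp huz
  exact hw (tendsto_nhds_unique hgw h1 ▸ h.bij.mapsTo hz)

lemma tendsto_im_nonneg (h : MapOut C F D' g) {u : ℕ → ℂ} {w : ℂ}
    (hu : ∀ n, u n ∈ outDom C F) (hgw : Tendsto (fun n => g (u n)) atTop (𝓝 w)) : 0 ≤ w.im :=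
  ge_of_tendsto' ((continuous_im.tendsto _).comp hgw) fun n => (h.im_pos (hu n)).le

end MapOut

/-- A connected set meeting `I` and avoiding a ring `O \ I` lies in `I`. -/
lemma IsPreconnected.subset_of_disjoint_ring {X : Type*} [TopologicalSpace X] {S I O : Set X}
    (hS : IsPreconnected S) (hI : IsOpen I) (hclO : closure I ⊆ O) (hd : Disjoint S (O \ I))
    (hne : (S ∩ I).Nonempty) : S ⊆ I := by
  refine hS.subset_of_closure_inter_subset hI hne ?_
  rintro z ⟨hz, hzS⟩
  by_contra hzI
  exact Set.disjoint_left.1 hd hzS ⟨hclO hz, hzI⟩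

/-- Slits have arbitrarily small connected rings around them. -/
lemma IsHorizontalSlit.exists_ring {C U : Set ℂ} (h : IsHorizontalSlit C) (hU : IsOpen U)
    (hCU : C ⊆ U) : ∃ I O : Set ℂ, IsOpen I ∧ IsCompact O ∧ closure I ⊆ O ∧ C ⊆ I ∧ O ⊆ U ∧
      IsPreconnected (O \ I) ∧ (O \ I).Nonempty := by
  obtain ⟨a, b, y, -, hab, rfl⟩ := h.exists_rect
  obtain ⟨ε, hε, hsub⟩ := exists_rect_subset hU hab.le le_rfl hCU
  refine ⟨Ioo (a - ε / 2) (b + ε / 2) ×ℂ Ioo (y - ε / 2) (y + ε / 2),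
    Icc (a - 2 * (ε / 2)) (b + 2 * (ε / 2)) ×ℂ Icc (y - 2 * (ε / 2)) (y + 2 * (ε / 2)),
    isOpen_rect _ _ _ _, isCompact_rect _ _ _ _, ?_, ?_, ?_,
    isPreconnected_rect_ring hab.le le_rfl (by positivity), ?_⟩
  · refine closure_minimal ?_ (isCompact_rect _ _ _ _).isClosed
    rintro z ⟨⟨h1, h2⟩, h3, h4⟩
    exact ⟨⟨by linarith, by linarith⟩, by linarith, by linarith⟩
  · rintro z ⟨⟨h1, h2⟩, h3, h4⟩
    exact ⟨⟨by linarith, by linarith⟩, by linarith, by linarith⟩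
  · exact hsub _ (by linarith)
  · refine ⟨⟨a, y + 2 * (ε / 2)⟩, ⟨⟨?_, ?_⟩, ?_, ?_⟩, fun hz => ?_⟩
    · show a - 2 * (ε / 2) ≤ a; linarith
    · show a ≤ b + 2 * (ε / 2); linarith
    · show y - 2 * (ε / 2) ≤ y + 2 * (ε / 2); linarith
    · exact le_rfl
    · have : y + 2 * (ε / 2) < y + ε / 2 := hz.2.2
      linarith

/-- A connected set joining `z` to `Ωᶜ` outside `K` shows that the component of `z` reaches
the boundary. -/
lemma closure_component_inter_compl_nonempty {Ω K S : Set ℂ} (hΩ : IsOpen Ω) (hK : IsClosed K)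
    (hS : IsPreconnected S) (hSK : Disjoint S K) (hSΩ : (S ∩ Ωᶜ).Nonempty) {z : ℂ} (hz : z ∈ S)
    (hzΩ : z ∈ Ω) : (closure (connectedComponentIn (Ω \ K) z) ∩ Ωᶜ).Nonempty := by
  by_contra hem
  rw [not_nonempty_iff_eq_empty] at hem
  have hUo : IsOpen (Ω \ K) := hΩ.sdiff hK
  have hzU : z ∈ Ω \ K := ⟨hzΩ, Set.disjoint_left.1 hSK hz⟩
  have hsub : S ⊆ connectedComponentIn (Ω \ K) z := by
    refine hS.subset_of_closure_inter_subset hUo.connectedComponentIn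
      ⟨z, hz, mem_connectedComponentIn hzU⟩ ?_
    rintro p ⟨hp, hpS⟩
    have hpΩ : p ∈ Ω := by
      by_contra h
      have : p ∈ closure (connectedComponentIn (Ω \ K) z) ∩ Ωᶜ := ⟨hp, h⟩
      rw [hem] at this; exact this
    have hpU : p ∈ Ω \ K := ⟨hpΩ, Set.disjoint_left.1 hSK hpS⟩
    have ho : IsOpen (connectedComponentIn (Ω \ K) p) := hUo.connectedComponentIn
    obtain ⟨w, hw, hwA⟩ := mem_closure_iff.1 hp _ ho (mem_connectedComponentIn hpU)
    rw [connectedComponentIn_eq hwA, ← connectedComponentIn_eq hw]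
    exact mem_connectedComponentIn hpU
  obtain ⟨p, hpS, hp⟩ := hSΩ
  exact hp (connectedComponentIn_subset _ _ (hsub hpS)).1

namespace MapOut

variable {N : ℕ} {C : Fin N → Set ℂ} {F D' : Set ℂ} {g : ℂ → ℂ}

/-- Boundary points of the hull complement are not mapped to slits. -/
lemma boundary_im_eq_zero (h : MapOut C F D' g) {u : ℕ → ℂ} {b w : ℂ}
    (hu : ∀ n, u n ∈ outDom C F) (hub : Tendsto u atTop (𝓝 b)) (hb : b ∉ UHP \ F)
    (hgw : Tendsto (fun n => g (u n)) atTop (𝓝 w)) : w.im = 0 := by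
  by_contra hne
  have hw0 : 0 < w.im := (h.tendsto_im_nonneg hu hgw).lt_of_ne' hne
  have hbG : b ∉ outDom C F := fun hb' => hb (by rw [dom_eq] at hb'; exact hb'.1)
  have hwD : w ∉ D' := h.tendsto_not_mem_target hu hub hbG hgw
  obtain ⟨k, hkd, hkm, hgk, hkg⟩ := h.exists_inverse
  obtain ⟨N', C', hC', hd', hD'⟩ := h.target
  have hwC : w ∈ ⋃ j, C' j := by
    by_contra hn
    exact hwD (hD' ▸ ⟨hw0, hn⟩)
  obtain ⟨i, hi⟩ := mem_iUnion.1 hwC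
  -- a ring around the slit
  have hUo : IsOpen (UHP \ ⋃ j : {j // j ≠ i}, C' j) :=
    isOpen_UHP.sdiff (isCompact_iUnion fun j : {j // j ≠ i} => (hC' j).isCompact).isClosed
  obtain ⟨I, O, hIo, hOc, hclO, hCI, hOU, hRp, hRn⟩ := (hC' i).exists_ring hUo (fun z hz =>
    ⟨(hC' i).subset_UHP hz, fun hz' => by
      obtain ⟨j, hj⟩ := mem_iUnion.1 hz'
      exact Set.disjoint_left.1 (hd' j.2) hj hz⟩)
  have hRD : O \ I ⊆ D' := by
    rintro z ⟨hzO, hzI⟩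
    rw [hD']
    refine ⟨(hOU hzO).1, fun hz' => ?_⟩
    obtain ⟨j, hj⟩ := mem_iUnion.1 hz'
    by_cases hji : j = i
    · subst hji; exact hzI (hCI hj)
    · exact (hOU hzO).2 (mem_iUnion.2 ⟨⟨j, hji⟩, hj⟩)
  have hRc : IsCompact (O \ I) := hOc.diff hIo
  set K := k '' (O \ I) with hKdef
  have hKc : IsCompact K := hRc.image_of_continuousOn (hkd.continuousOn.mono hRD)
  have hKp : IsPreconnected K := hRp.image _ (hkd.continuousOn.mono hRD)
  have hKG : K ⊆ outDom C F := by
    rintro _ ⟨z, hz, rfl⟩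
    exact hkm (hRD hz)
  have hKΩ : K ⊆ UHP \ F := hKG.trans (by rw [dom_eq]; exact sdiff_subset)
  have hgK : ∀ z ∈ K, g z ∈ O \ I := by
    rintro _ ⟨z, hz, rfl⟩
    rwa [hgk z (hRD hz)]
  have hΩo := isOpen_hull_compl h.hull
  -- a point of the sequence close to the boundary
  have hbK : b ∉ K := fun hbK => hb (hKΩ hbK)
  obtain ⟨r, hr, hrK⟩ := Metric.isOpen_iff.1 hKc.isClosed.isOpen_compl b hbK
  obtain ⟨n, hn1, hn2⟩ := ((hub.eventually (ball_mem_nhds b hr)).and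
    (hgw.eventually (hIo.mem_nhds (hCI hi)))).exists
  set x := u n with hx
  have hxG : x ∈ outDom C F := hu n
  have hxK : x ∉ K := fun hxK => hrK hn1 hxK
  have hxΩ : x ∈ UHP \ F := by
    have := hxG; rw [dom_eq] at this; exact this.1
  have hxP := closure_component_inter_compl_nonempty hΩo hKc.isClosed
    (convex_ball b r).isPreconnected (Set.disjoint_left.2 fun z hz => hrK hz)
    ⟨b, mem_ball_self hr, hb⟩ hn1 hxΩ
  -- a far point
  obtain ⟨R₁, hR₁⟩ := h.exists_far
  obtain ⟨R₂, hR₂⟩ := hKc.isBounded.exists_norm_le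
  obtain ⟨R₃, hR₃⟩ := hOc.isBounded.exists_norm_le
  obtain ⟨B, hB⟩ := h.exists_bound
  set X : ℝ := |R₁| + |R₂| + |R₃| + |B| + 1 with hX
  have hXle : ∀ y : ℝ, X ≤ ‖(⟨X, y⟩ : ℂ)‖ := fun y =>
    (le_abs_self _).trans (abs_re_le_norm (⟨X, y⟩ : ℂ))
  have b1 := le_abs_self R₁
  have b2 := le_abs_self R₂
  have b3 := le_abs_self R₃
  have b4 := le_abs_self B
  have c1 := abs_nonneg R₁
  have c2 := abs_nonneg R₂
  have c3 := abs_nonneg R₃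
  have c4 := abs_nonneg B
  have hyG : (⟨X, 1⟩ : ℂ) ∈ outDom C F := hR₁ _ one_pos (by linarith [hXle 1])
  have hyΩ : (⟨X, 1⟩ : ℂ) ∈ UHP \ F := by
    have := hyG; rw [dom_eq] at this; exact this.1
  have hyP := closure_component_inter_compl_nonempty (z := ⟨X, 1⟩) (S := {z | z.re = X}) hΩo
    hKc.isClosed ((convex_singleton X).linear_preimage reLm).isPreconnected
    (Set.disjoint_left.2 fun z hz hzK => by
      have h1 := hR₂ z hzK
      have h2 := abs_re_le_norm z
      rw [show z.re = X from hz] at h2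
      linarith [le_abs_self X])
    ⟨⟨X, 0⟩, rfl, fun h0 => lt_irrefl (0 : ℝ) h0.1⟩ rfl hyΩ
  have hyK : (⟨X, 1⟩ : ℂ) ∉ K := fun h0 => by
    have := hR₂ _ h0; linarith [hXle 1]
  have hyW := connectedComponentIn_eq_of_closure_meets hΩo h.hull.2.2.1.isPreconnected
    (isPreconnected_compl_hull h.hull h.bdd) hKc.isClosed hKp hKΩ (hRn.image _) ⟨hxΩ, hxK⟩
    ⟨hyΩ, hyK⟩ hxP hyP
  set W := connectedComponentIn ((UHP \ F) \ K) x with hW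
  have hWo : IsOpen W := (hΩo.sdiff hKc.isClosed).connectedComponentIn
  have hWsub : W ⊆ (UHP \ F) \ K := connectedComponentIn_subset _ _
  have hWp : IsPreconnected (W \ ⋃ j, C j) := by
    refine isPreconnected_connectedComponentIn.diff_slits hWo h.slit h.disj fun j => ?_
    by_cases hj : Disjoint (C j) W
    · exact Or.inr hj
    · left
      obtain ⟨p, hpC, hpW⟩ := Set.not_disjoint_iff.1 hj
      have hCp : IsPreconnected (C j) := by
        obtain ⟨a', b', y', -, -, e⟩ := (h.slit j).exists_rect
        rw [e]
        exact (convex_reProdIm (convex_Icc _ _) (convex_Icc _ _)).isPreconnected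
      rw [connectedComponentIn_eq hpW]
      refine hCp.subset_connectedComponentIn hpC fun q hq => ⟨h.slits_subset (mem_iUnion.2 ⟨j, hq⟩),
        fun hqK => (hKG hqK).1.2 (mem_iUnion.2 ⟨j, hq⟩)⟩
  have hWG : W \ ⋃ j, C j ⊆ outDom C F := by
    rintro z ⟨hz, hz'⟩
    rw [dom_eq]
    exact ⟨(hWsub hz).1, hz'⟩
  have him := hWp.image g (h.diff.continuousOn.mono hWG)
  have hfin := him.subset_of_disjoint_ring hIo hclO (by
      rw [Set.disjoint_left]
      rintro _ ⟨z, hz, rfl⟩ hgz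
      exact (hWsub hz.1).2 ⟨g z, hgz, hkg z (hWG hz)⟩)
    ⟨g x, mem_image_of_mem _ ⟨mem_connectedComponentIn ⟨hxΩ, hxK⟩, hxG.1.2⟩, hn2⟩
  have hgy : g ⟨X, 1⟩ ∈ I := hfin (mem_image_of_mem _ ⟨hyW, hyG.1.2⟩)
  have h1 := hR₃ _ (hclO (subset_closure hgy))
  have h2 := hB _ hyG
  have h3 := norm_sub_norm_le (⟨X, 1⟩ : ℂ) (g ⟨X, 1⟩)
  rw [norm_sub_rev] at h3
  linarith [hXle 1]

lemma exists_strip (h : MapOut C F D' g) : ∃ m > 0, ∀ w : ℂ, 0 < w.im → w.im < m → w ∈ D' := by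
  obtain ⟨Y, hY, -, hY0⟩ := h.target.exists_heights
  have h1 : ∀ᶠ m in 𝓝[>] (0 : ℝ), ∀ y ∈ Y ∩ Ioi 0, m ≤ y := by
    rw [eventually_all_finite (hY.inter_of_left _)]
    intro y hy
    exact eventually_nhdsWithin_of_eventually_nhds (eventually_le_nhds hy.2)
  obtain ⟨m, hm, hm0⟩ := (h1.and self_mem_nhdsWithin).exists
  refine ⟨m, hm0, fun w h1 h2 => ?_⟩
  by_contra hw
  exact not_lt.2 (hm _ ⟨hY0 w hw h1.le, h1⟩) h2

/-- Slits of the domain are mapped away from the real line. -/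
lemma exists_slit_bound (h : MapOut C F D' g) : ∃ m > 0, ∀ p ∈ ⋃ j, C j,
    ∀ᶠ z in 𝓝[outDom C F] p, m ≤ (g z).im := by
  obtain ⟨k, hkd, hkm, hgk, hkg⟩ := h.exists_inverse
  obtain ⟨m₀, hm₀, hstrip⟩ := h.exists_strip
  obtain ⟨B, hB⟩ := h.exists_bound
  have key : ∀ j, ∃ m > 0, ∀ p ∈ C j, ∀ᶠ z in 𝓝[outDom C F] p, m ≤ (g z).im := by
    intro i
    have hUo : IsOpen ((UHP \ F) \ ⋃ j : {j // j ≠ i}, C j) := (isOpen_hull_compl h.hull).sdiff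
      (isCompact_iUnion fun j : {j // j ≠ i} => (h.slit j).isCompact).isClosed
    obtain ⟨I, O, hIo, hOc, hclO, hCI, hOU, hRp, hRn⟩ := (h.slit i).exists_ring hUo (fun z hz =>
      ⟨h.slits_subset (mem_iUnion.2 ⟨i, hz⟩), fun hz' => by
        obtain ⟨j, hj⟩ := mem_iUnion.1 hz'
        exact Set.disjoint_left.1 (h.disj j.2) hj hz⟩)
    have hRG : O \ I ⊆ outDom C F := by
      rintro z ⟨hzO, hzI⟩
      rw [dom_eq]
      refine ⟨(hOU hzO).1, fun hz' => ?_⟩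
      obtain ⟨j, hj⟩ := mem_iUnion.1 hz'
      by_cases hji : j = i
      · subst hji; exact hzI (hCI hj)
      · exact (hOU hzO).2 (mem_iUnion.2 ⟨⟨j, hji⟩, hj⟩)
    obtain ⟨q, hq, hqmin⟩ := (hOc.diff hIo).exists_isMinOn hRn (f := fun z => (g z).im)
      (continuous_im.comp_continuousOn (h.diff.continuousOn.mono hRG))
    have hq0 : 0 < (g q).im := h.im_pos (hRG hq)
    set m := min m₀ (g q).im with hm
    refine ⟨m, lt_min hm₀ hq0, fun p hp => ?_⟩
    filter_upwards [mem_nhdsWithin_of_mem_nhds (hIo.mem_nhds (hCI hp)), self_mem_nhdsWithin]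
      with z hzI hzG
    by_contra hlt
    push Not at hlt
    set S : Set ℂ := {w | w.im ∈ Ioo 0 m} with hS
    have hSD : S ⊆ D' := fun w hw => hstrip w hw.1 (hw.2.trans_le (min_le_left _ _))
    have hSp : IsPreconnected S := by
      exact ((convex_Ioo 0 m).linear_preimage imLm).isPreconnected
    have hsub := (hSp.image k (hkd.continuousOn.mono hSD)).subset_of_disjoint_ring hIo hclO (by
        rw [Set.disjoint_left]
        rintro _ ⟨w, hw, rfl⟩ hkw
        have h1 : (g q).im ≤ (g (k w)).im := hqmin hkw
        rw [hgk w (hSD hw)] at h1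
        have h2 := hw.2
        have h3 := min_le_right m₀ (g q).im
        linarith)
      ⟨z, ⟨g z, ⟨h.im_pos hzG, hlt⟩, hkg z hzG⟩, hzI⟩
    obtain ⟨R, hR⟩ := hOc.isBounded.exists_norm_le
    have hmpos : 0 < m := lt_min hm₀ hq0
    have hw : (⟨|R| + |B| + 1, m / 2⟩ : ℂ) ∈ S :=
      ⟨by show 0 < m / 2; linarith, by show m / 2 < m; linarith⟩
    have h1 := hR _ (hclO (subset_closure (hsub (mem_image_of_mem k hw))))
    have h2 := hB _ (hkm (hSD hw))
    rw [hgk _ (hSD hw)] at h2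
    have h3 := norm_sub_norm_le (⟨|R| + |B| + 1, m / 2⟩ : ℂ) (k ⟨|R| + |B| + 1, m / 2⟩)
    have h4 : |R| + |B| + 1 ≤ ‖(⟨|R| + |B| + 1, m / 2⟩ : ℂ)‖ :=
      (le_abs_self _).trans (abs_re_le_norm (⟨|R| + |B| + 1, m / 2⟩ : ℂ))
    linarith [le_abs_self R, le_abs_self B]
  choose m hm hmj using key
  have h1 : ∀ᶠ x in 𝓝[>] (0 : ℝ), ∀ j, x ≤ m j := by
    rw [eventually_all]
    intro j
    exact eventually_nhdsWithin_of_eventually_nhds (eventually_le_nhds (hm j))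
  obtain ⟨x, hx, hx0⟩ := (h1.and self_mem_nhdsWithin).exists
  refine ⟨x, hx0, fun p hp => ?_⟩
  obtain ⟨j, hj⟩ := mem_iUnion.1 hp
  filter_upwards [hmj j p hj] with z hz using (hx j).trans hz

end MapOut

lemma det_restrictScalars_toSpanSingleton (a : ℂ) :
    ((ContinuousLinearMap.toSpanSingleton ℂ a).restrictScalars ℝ).det = ‖a‖ ^ 2 := by
  have h := DFunLike.congr_fun Algebra.norm_complex_eq a
  rw [Algebra.norm_apply] at h
  rw [ContinuousLinearMap.det, ← normSq_eq_norm_sq]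
  refine Eq.trans ?_ h
  congr 1
  ext x
  all_goals simp [mul_comm]

lemma volume_image_eq {V : Set ℂ} (hV : IsOpen V) {g : ℂ → ℂ} (hg : DifferentiableOn ℂ g V)
    (hi : InjOn g V) : ∫⁻ w in V, ENNReal.ofReal (‖deriv g w‖ ^ 2) = volume (g '' V) := by
  rw [← lintegral_abs_det_fderiv_eq_addHaar_image volume hV.measurableSet (f := g)
    (f' := fun w => (ContinuousLinearMap.toSpanSingleton ℂ (deriv g w)).restrictScalars ℝ)
    (fun w hw => ?_) hi]
  · simp only [det_restrictScalars_toSpanSingleton]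
    simp
  · exact ((hg.differentiableAt (hV.mem_nhds hw)).hasDerivAt.hasFDerivAt.restrictScalars
      ℝ).hasFDerivWithinAt

lemma exists_circleMap_eq {b w : ℂ} {r : ℝ} (hw : w ∈ sphere b r) :
    ∃ θ ∈ Ioc (-Real.pi) Real.pi, circleMap b r θ = w := by
  refine ⟨arg (w - b), ⟨neg_pi_lt_arg _, arg_le_pi _⟩, ?_⟩
  have : ‖w - b‖ = r := by simpa [dist_eq_norm] using hw
  rw [circleMap, ← this, norm_mul_exp_arg_mul_I]
  ring

lemma volume_image_circle_le {U : Set ℂ} (hU : IsOpen U) {g : ℂ → ℂ}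
    (hg : DifferentiableOn ℂ g U) {b : ℂ} {r : ℝ} (hr : 0 < r) {φ : ℂ →L[ℝ] ℝ}
    (hφ : ∀ z, |φ z| ≤ ‖z‖) :
    volume (φ '' (g '' (U ∩ sphere b r))) ≤
      ∫⁻ θ in Ioc (-Real.pi) Real.pi ∩ circleMap b r ⁻¹' U,
        ENNReal.ofReal (‖deriv g (circleMap b r θ)‖ * r) := by
  set J := Ioc (-Real.pi) Real.pi ∩ circleMap b r ⁻¹' U with hJ
  have hJm : MeasurableSet J :=
    measurableSet_Ioc.inter (hU.preimage (continuous_circleMap b r)).measurableSet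
  have hder : ∀ θ ∈ J, HasDerivAt (fun θ => φ (g (circleMap b r θ)))
      (φ (deriv g (circleMap b r θ) * (circleMap 0 r θ * I))) θ := by
    intro θ hθ
    have h1 : HasDerivAt g (deriv g (circleMap b r θ)) (circleMap b r θ) :=
      (hg.differentiableAt (hU.mem_nhds hθ.2)).hasDerivAt
    have h2 := h1.comp θ (hasDerivAt_circleMap b r θ)
    exact φ.hasFDerivAt.comp_hasDerivAt θ h2
  have hsub : φ '' (g '' (U ∩ sphere b r)) ⊆ (fun θ => φ (g (circleMap b r θ))) '' J := by
    rintro _ ⟨_, ⟨w, ⟨hwU, hws⟩, rfl⟩, rfl⟩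
    obtain ⟨θ, hθ, rfl⟩ := exists_circleMap_eq hws
    exact ⟨θ, ⟨hθ, hwU⟩, rfl⟩
  refine (measure_mono hsub).trans ?_
  refine (addHaar_image_le_lintegral_abs_det_fderiv volume hJm
    (fun θ hθ => (hder θ hθ).hasFDerivAt.hasFDerivWithinAt)).trans ?_
  refine setLIntegral_mono' hJm fun θ hθ => ENNReal.ofReal_le_ofReal ?_
  rw [ContinuousLinearMap.det_toSpanSingleton]
  refine (hφ _).trans ?_
  simp [abs_of_pos hr]

lemma ofReal_le_of_lt_lintegral_circle {U : Set ℂ} {g : ℂ → ℂ} {b : ℂ}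
    {r η : ℝ} (hr : 0 < r) (hη : 0 < η)
    (h : ENNReal.ofReal η < ∫⁻ θ in Ioc (-Real.pi) Real.pi ∩ circleMap b r ⁻¹' U,
        ENNReal.ofReal (‖deriv g (circleMap b r θ)‖ * r)) :
    ENNReal.ofReal (η ^ 2 / (2 * Real.pi) * (1 / r)) ≤
      ∫⁻ θ in Ioc (-Real.pi) Real.pi ∩ circleMap b r ⁻¹' U,
        ENNReal.ofReal (r * ‖deriv g (circleMap b r θ)‖ ^ 2) := by
  set J := Ioc (-Real.pi) Real.pi ∩ circleMap b r ⁻¹' U with hJ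
  have hpi := Real.pi_pos
  set l : ℝ := η / (2 * Real.pi) with hl
  have hlpos : 0 < l := by positivity
  have hvol : volume J ≤ ENNReal.ofReal (2 * Real.pi) := by
    refine (measure_mono inter_subset_left).trans ?_
    rw [Real.volume_Ioc]
    exact ENNReal.ofReal_le_ofReal (by linarith)
  have h1 : ENNReal.ofReal (2 * l / r * η) ≤
      (∫⁻ θ in J, ENNReal.ofReal (r * ‖deriv g (circleMap b r θ)‖ ^ 2)) +
        ENNReal.ofReal (l ^ 2 / r * (2 * Real.pi)) := by
    calc ENNReal.ofReal (2 * l / r * η) = ENNReal.ofReal (2 * l / r) * ENNReal.ofReal η :=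
          ENNReal.ofReal_mul (by positivity)
      _ ≤ ENNReal.ofReal (2 * l / r) *
          ∫⁻ θ in J, ENNReal.ofReal (‖deriv g (circleMap b r θ)‖ * r) := by gcongr
      _ = ∫⁻ θ in J, ENNReal.ofReal (2 * l / r) *
          ENNReal.ofReal (‖deriv g (circleMap b r θ)‖ * r) :=
          (lintegral_const_mul' _ _ ENNReal.ofReal_ne_top).symm
      _ ≤ ∫⁻ θ in J, (ENNReal.ofReal (r * ‖deriv g (circleMap b r θ)‖ ^ 2) +
          ENNReal.ofReal (l ^ 2 / r)) := by
          refine lintegral_mono fun θ => ?_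
          rw [← ENNReal.ofReal_mul (by positivity), ← ENNReal.ofReal_add (by positivity)
            (by positivity)]
          refine ENNReal.ofReal_le_ofReal ?_
          set x := ‖deriv g (circleMap b r θ)‖
          have e : r * x ^ 2 + l ^ 2 / r - 2 * l / r * (x * r) = (r * x - l) ^ 2 / r := by
            field_simp; ring
          have : 0 ≤ (r * x - l) ^ 2 / r := by positivity
          linarith
      _ = (∫⁻ θ in J, ENNReal.ofReal (r * ‖deriv g (circleMap b r θ)‖ ^ 2)) +
          ENNReal.ofReal (l ^ 2 / r) * volume J := by
          rw [lintegral_add_right _ measurable_const, setLIntegral_const]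
      _ ≤ _ := by
          rw [ENNReal.ofReal_mul (p := l ^ 2 / r) (by positivity)]
          gcongr
  have e : 2 * l / r * η = η ^ 2 / (2 * Real.pi) * (1 / r) + l ^ 2 / r * (2 * Real.pi) := by
    rw [hl]; field_simp; ring
  rw [e, ENNReal.ofReal_add (by positivity) (by positivity)] at h1
  exact ENNReal.le_of_add_le_add_right ENNReal.ofReal_ne_top h1

/-- Length–area principle: some circle has an image with small coordinate projections. -/
lemma exists_circle_image_small {U : Set ℂ} (hU : IsOpen U) {g : ℂ → ℂ}
    (hg : DifferentiableOn ℂ g U) (hi : InjOn g U) {b : ℂ} {r₁ r₂ A η : ℝ} (hr₁ : 0 < r₁)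
    (hr : r₁ < r₂) (hη : 0 < η)
    (harea : volume (g '' (U ∩ ball b r₂)) ≤ ENNReal.ofReal A)
    (h : 2 * Real.pi * A < η ^ 2 * Real.log (r₂ / r₁)) :
    ∃ r ∈ Ioo r₁ r₂, volume (re '' (g '' (U ∩ sphere b r))) ≤ ENNReal.ofReal η ∧
      volume (im '' (g '' (U ∩ sphere b r))) ≤ ENNReal.ofReal η := by
  by_contra hcon
  push Not at hcon
  have hpi := Real.pi_pos
  have hlarge : ∀ r ∈ Ioo r₁ r₂, ENNReal.ofReal η <
      ∫⁻ θ in Ioc (-Real.pi) Real.pi ∩ circleMap b r ⁻¹' U,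
        ENNReal.ofReal (‖deriv g (circleMap b r θ)‖ * r) := by
    intro r hrr
    have hr0 : 0 < r := hr₁.trans hrr.1
    by_cases hre : volume (re '' (g '' (U ∩ sphere b r))) ≤ ENNReal.ofReal η
    · exact (hcon r hrr hre).trans_le
        (volume_image_circle_le hU hg hr0 (φ := imCLM) (fun z => abs_im_le_norm z))
    · exact (not_le.1 hre).trans_le
        (volume_image_circle_le hU hg hr0 (φ := reCLM) (fun z => abs_re_le_norm z))
  set V := U ∩ ball b r₂ with hV
  have hVo : IsOpen V := hU.inter isOpen_ball
  set f : ℂ → ENNReal := V.indicator fun w => ENNReal.ofReal (‖deriv g w‖ ^ 2) with hf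
  have hfm : Measurable f := by
    refine Measurable.indicator ?_ hVo.measurableSet
    have := measurable_deriv g
    fun_prop
  have hfint : ∫⁻ w, f w ≤ ENNReal.ofReal A := by
    rw [hf, lintegral_indicator hVo.measurableSet, volume_image_eq hVo (hg.mono inter_subset_left)
      (hi.mono inter_subset_left)]
    exact harea
  rw [← lintegral_add_left_eq_self f b, ← Complex.lintegral_comp_polarCoord_symm,
    polarCoord_target, Measure.volume_eq_prod, setLIntegral_prod] at hfint
  · have hlow : ∫⁻ r in Ioo r₁ r₂, ENNReal.ofReal (η ^ 2 / (2 * Real.pi) * (1 / r)) ≤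
        ENNReal.ofReal A := by
      refine le_trans (le_trans ?_ (lintegral_mono_set (s := Ioo r₁ r₂) (t := Ioi 0)
        fun r hrr => hr₁.trans hrr.1)) hfint
      refine setLIntegral_mono' measurableSet_Ioo fun r hrr => ?_
      have hr0 : 0 < r := hr₁.trans hrr.1
      refine (ofReal_le_of_lt_lintegral_circle hr0 hη (hlarge r hrr)).trans ?_
      rw [restrict_Ioo_eq_restrict_Ioc]
      refine le_trans (setLIntegral_mono' ?_ fun θ hθ => ?_) (lintegral_mono_set inter_subset_left)
      · exact measurableSet_Ioc.inter (hU.preimage (continuous_circleMap b r)).measurableSet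
      · have e : b + Complex.polarCoord.symm (r, θ) = circleMap b r θ := by
          rw [Complex.polarCoord_symm_apply, circleMap, exp_mul_I]
          simp
        have hmem : circleMap b r θ ∈ V := ⟨hθ.2, by
          rw [mem_ball, dist_eq_norm, circleMap_sub_center, norm_circleMap_zero, abs_of_pos hr0]
          exact hrr.2⟩
        rw [e, hf, indicator_of_mem hmem, smul_eq_mul, ← ENNReal.ofReal_mul hr0.le]
    have hval : IntervalIntegrable (fun r : ℝ => η ^ 2 / (2 * Real.pi) * (1 / r)) volume r₁ r₂ := by
      refine ContinuousOn.intervalIntegrable fun x hx => ContinuousAt.continuousWithinAt ?_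
      rw [uIcc_of_le hr.le] at hx
      have : x ≠ 0 := (hr₁.trans_le hx.1).ne'
      fun_prop (disch := assumption)
    rw [restrict_Ioo_eq_restrict_Ioc, ← ofReal_integral_eq_lintegral_ofReal
      ((intervalIntegrable_iff_integrableOn_Ioc_of_le hr.le).1 hval),
      ← intervalIntegral.integral_of_le hr.le, intervalIntegral.integral_const_mul,
      integral_one_div_of_pos hr₁ (hr₁.trans hr)] at hlow
    · have hlog : 0 < Real.log (r₂ / r₁) := Real.log_pos (by rwa [one_lt_div hr₁])
      have hlt : A < η ^ 2 / (2 * Real.pi) * Real.log (r₂ / r₁) := by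
        rw [div_mul_eq_mul_div, lt_div_iff₀ (by positivity)]
        linarith
      exact not_lt.2 hlow ((ENNReal.ofReal_lt_ofReal_iff (by positivity)).2 hlt)
    · filter_upwards [ae_restrict_mem measurableSet_Ioc] with x hx
      have : 0 < x := hr₁.trans hx.1
      show 0 ≤ η ^ 2 / (2 * Real.pi) * (1 / x)
      positivity
  · refine Measurable.aemeasurable ?_
    have e : (fun p : ℝ × ℝ => b + Complex.polarCoord.symm p) =
        fun p => b + p.1 * (Real.cos p.2 + Real.sin p.2 * I) := by
      funext p; rw [Complex.polarCoord_symm_apply]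
    have hm : Measurable (fun p : ℝ × ℝ => b + Complex.polarCoord.symm p) := by
      rw [e]; fun_prop
    have := hfm.comp hm
    simp only [smul_eq_mul]
    exact (ENNReal.measurable_ofReal.comp measurable_fst).mul this

/-- A preconnected set of reals has diameter at most its length. -/
lemma IsPreconnected.sub_le_of_volume_le {s : Set ℝ} (hs : IsPreconnected s) {η : ℝ} (hη : 0 ≤ η)
    (h : volume s ≤ ENNReal.ofReal η) {x y : ℝ} (hx : x ∈ s) (hy : y ∈ s) : y - x ≤ η := by
  have h1 : Icc x y ⊆ s := hs.Icc_subset hx hy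
  have h2 := (measure_mono h1).trans h
  rw [Real.volume_Icc, ENNReal.ofReal_le_ofReal_iff hη] at h2
  exact h2

lemma IsPreconnected.inter_frontier_nonempty_of_isOpen {X : Type*} [TopologicalSpace X]
    {S O : Set X} (hS : IsPreconnected S) (hO : IsOpen O) (h1 : (S ∩ O).Nonempty)
    (h2 : ¬ S ⊆ O) : (S ∩ frontier O).Nonempty := by
  by_contra hem
  rw [not_nonempty_iff_eq_empty] at hem
  refine h2 (hS.subset_of_closure_inter_subset hO h1 ?_)
  rintro z ⟨hz, hzS⟩
  by_contra hzO
  have : z ∈ S ∩ frontier O := ⟨hzS, hz, by rwa [hO.interior_eq]⟩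
  rw [hem] at this
  exact this

lemma mem_closure_im_not_mem {O : Set ℂ} (hO : IsOpen O) {Y : Set ℝ} (hY : Y.Finite) {p : ℂ}
    (hp : p ∈ O) : p ∈ closure {z ∈ O | z.im ∉ Y} := by
  rw [Metric.mem_closure_iff]
  intro ε hε
  have h1 : ∀ᶠ t : ℝ in 𝓝[>] (0 : ℝ), p + (t : ℂ) * I ∈ O := by
    have hc : ContinuousAt (fun t : ℝ => p + t * I) 0 := by fun_prop
    exact (hc.tendsto.eventually (hO.mem_nhds (by simpa using hp))).filter_mono nhdsWithin_le_nhds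
  have h2 : ∀ᶠ t in 𝓝[>] (0 : ℝ), ∀ y ∈ Y, p.im + t ≠ y := by
    rw [eventually_all_finite hY]
    intro y _
    by_cases hy : y = p.im
    · filter_upwards [self_mem_nhdsWithin] with t ht h
      have : 0 < t := ht
      linarith
    · refine eventually_nhdsWithin_of_eventually_nhds ?_
      have hc : ContinuousAt (fun t : ℝ => p.im + t) 0 := by fun_prop
      exact hc.eventually_ne (by simpa using fun h : p.im = y => hy h.symm)
  have h3 : ∀ᶠ t in 𝓝[>] (0 : ℝ), t < ε :=
    eventually_nhdsWithin_of_eventually_nhds (eventually_lt_nhds hε)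
  obtain ⟨t, ⟨ht1, ht2⟩, ht3, ht0⟩ := ((h1.and h2).and (h3.and self_mem_nhdsWithin)).exists
  have ht0' : 0 < t := ht0
  refine ⟨p + t * I, ⟨ht1, fun h => ht2 _ h (by simp)⟩, ?_⟩
  simpa [dist_eq_norm, abs_of_pos ht0'] using ht3

/-- A bounded open set whose frontier lies in a closed convex set, up to finitely many horizontal
lines, is contained in the convex set. -/
lemma subset_of_frontier {O : Set ℂ} (hO : IsOpen O) (hb : IsBounded O) {Y : Set ℝ}
    (hY : Y.Finite) {R : Set ℂ} (hRc : IsClosed R) (hR : Convex ℝ R)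
    (h : ∀ q ∈ frontier O, q.im ∈ Y ∨ q ∈ R) : O ⊆ R := by
  obtain ⟨M, hM⟩ := hb.exists_norm_le
  have key : {z ∈ O | z.im ∉ Y} ⊆ R := by
    rintro p ⟨hp, hpY⟩
    have side : ∀ s : Set ℝ, Convex ℝ s → (0 : ℝ) ∈ s → (∃ x ∈ s, M < |p.re + x|) →
        ∃ x ∈ s, p + (x : ℂ) ∈ R := by
      intro s hs h0 ⟨y, hys, hy⟩
      have hpre : IsPreconnected ((fun x : ℝ => p + (x : ℂ)) '' s) :=
        hs.isPreconnected.image _ (by fun_prop)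
      obtain ⟨q, ⟨x, hx, rfl⟩, hq⟩ := hpre.inter_frontier_nonempty_of_isOpen hO
        ⟨p, ⟨0, h0, by simp⟩, hp⟩ (fun hsub => by
          have h1 := hM _ (hsub (mem_image_of_mem _ hys))
          have h2 := abs_re_le_norm (p + (y : ℂ))
          rw [add_re, ofReal_re] at h2
          linarith)
      refine ⟨x, hx, (h _ hq).resolve_left ?_⟩
      simpa using hpY
    have m1 := neg_abs_le M
    have m2 := le_abs_self M
    obtain ⟨x₁, hx₁, hq₁⟩ := side (Ici 0) (convex_Ici 0) (mem_Ici.2 le_rfl)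
      ⟨|M| + |p.re| + 1, by simp only [mem_Ici]; positivity, by
        refine lt_of_lt_of_le ?_ (le_abs_self _)
        linarith [neg_abs_le p.re]⟩
    obtain ⟨x₂, hx₂, hq₂⟩ := side (Iic 0) (convex_Iic 0) (mem_Iic.2 le_rfl)
      ⟨-(|M| + |p.re| + 1), by simp only [mem_Iic, neg_nonpos]; positivity, by
        refine lt_of_lt_of_le ?_ (neg_le_abs _)
        linarith [le_abs_self p.re]⟩
    have hx₁' : 0 ≤ x₁ := hx₁
    have hx₂' : x₂ ≤ 0 := hx₂
    rcases eq_or_lt_of_le (show 0 ≤ x₁ - x₂ by linarith) with he | hlt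
    · have : x₁ = 0 := by linarith
      rw [this] at hq₁
      simpa using hq₁
    · have := hR hq₂ hq₁ (a := x₁ / (x₁ - x₂)) (b := -x₂ / (x₁ - x₂)) (by positivity)
        (div_nonneg (by linarith) hlt.le) (by field_simp; ring)
      convert this using 1
      have hne : ((x₁ : ℂ) - x₂) ≠ 0 := by
        rw [← ofReal_sub]; exact ofReal_ne_zero.2 hlt.ne'
      simp only [real_smul]
      push_cast
      field_simp
      ring
  intro p hp
  exact closure_minimal key hRc (mem_closure_im_not_mem hO hY hp)

/-- A holomorphic function with limit zero at infinity and boundary values in a closed convex set,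
up to finitely many horizontal lines, is zero or takes its values in that set. -/
lemma eq_zero_or_mapsTo_of_boundary {G : Set ℂ} (hGo : IsOpen G) (hGp : IsPreconnected G)
    (hl : (cobounded ℂ ⊓ 𝓟 G).NeBot) {f : ℂ → ℂ} (hf : DifferentiableOn ℂ f G) {B : ℝ}
    (hB : ∀ z ∈ G, ‖f z‖ ≤ B) (h0 : Tendsto f (cobounded ℂ ⊓ 𝓟 G) (𝓝 0)) {Y : Set ℝ}
    (hY : Y.Finite) (hY0 : 0 ∈ Y) {R : Set ℂ} (hRc : IsClosed R) (hR : Convex ℝ R)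
    (hbd : ∀ u : ℕ → ℂ, (∀ n, u n ∈ G) → ∀ z q, Tendsto u atTop (𝓝 z) → z ∉ G →
      Tendsto (fun n => f (u n)) atTop (𝓝 q) → q.im ∈ Y ∨ q ∈ R) :
    (∀ z ∈ G, f z = 0) ∨ ((∀ z ∈ G, f z ∈ R) ∧ 0 ∈ R) := by
  rcases (hf.analyticOnNhd hGo).is_constant_or_isOpen hGp with ⟨w, hw⟩ | hopen
  · left
    have h1 : Tendsto f (cobounded ℂ ⊓ 𝓟 G) (𝓝 w) :=
      tendsto_const_nhds.congr' (by
        filter_upwards [mem_inf_of_right (mem_principal_self G)] with z hz using (hw z hz).symm)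
    have := tendsto_nhds_unique h1 h0
    intro z hz
    rw [hw z hz, this]
  · right
    have hO := hopen G subset_rfl hGo
    have hb : IsBounded (f '' G) := isBounded_iff_forall_norm_le.2 ⟨B, by
      rintro _ ⟨z, hz, rfl⟩; exact hB z hz⟩
    have hsub : f '' G ⊆ R := by
      refine subset_of_frontier hO hb hY hRc hR fun q hq => ?_
      have hq1 : q ∈ closure (f '' G) := hq.1
      have hq2 : q ∉ f '' G := by have := hq.2; rwa [hO.interior_eq] at this
      obtain ⟨v, hv, hvq⟩ := mem_closure_iff_seq_limit.1 hq1
      choose u hu huv using hv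
      have hfu : Tendsto (fun n => f (u n)) atTop (𝓝 q) := by simpa [huv] using hvq
      by_cases hcob : Tendsto u atTop (cobounded ℂ)
      · left
        have h1 : Tendsto u atTop (cobounded ℂ ⊓ 𝓟 G) :=
          tendsto_inf.2 ⟨hcob, tendsto_principal.2 (Eventually.of_forall hu)⟩
        rw [tendsto_nhds_unique hfu (h0.comp h1)]
        exact hY0
      · have hfr : ∃ r : ℝ, ∃ᶠ n in atTop, u n ∈ closedBall (0 : ℂ) r := by
          by_contra hcon
          push Not at hcon
          refine hcob ((hasBasis_cobounded_norm (E := ℂ)).tendsto_right_iff.2 fun r _ => ?_)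
          filter_upwards [hcon r] with n hn
          simp only [mem_closedBall, dist_zero_right, not_le] at hn
          exact hn.le
        obtain ⟨r, hr⟩ := hfr
        obtain ⟨z, -, φ, hφ, hz⟩ := tendsto_subseq_of_frequently_bounded isBounded_closedBall hr
        have hfz : Tendsto (fun n => f (u (φ n))) atTop (𝓝 q) := hfu.comp hφ.tendsto_atTop
        refine hbd (u ∘ φ) (fun n => hu _) z q hz (fun hzG => hq2 ⟨z, hzG, ?_⟩) hfz
        have := (hf.continuousOn.continuousAt (hGo.mem_nhds hzG)).tendsto.comp hz
        exact tendsto_nhds_unique this hfz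
    exact ⟨fun z hz => hsub (mem_image_of_mem _ hz), hRc.mem_of_tendsto h0 (by
      filter_upwards [mem_inf_of_right (mem_principal_self G)] with z hz
        using hsub (mem_image_of_mem _ hz))⟩

/-- Open half-annuli centred on the real line. -/
def halfAnnulus (x r₁ r₂ : ℝ) : Set ℂ := {w | 0 < w.im ∧ r₁ < ‖w - x‖ ∧ ‖w - x‖ < r₂}

lemma isOpen_halfAnnulus (x r₁ r₂ : ℝ) : IsOpen (halfAnnulus x r₁ r₂) := by
  have h : Continuous fun w : ℂ => ‖w - x‖ := by fun_prop
  exact (isOpen_lt continuous_const continuous_im).inter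
    ((isOpen_lt continuous_const h).inter (isOpen_lt h continuous_const))

lemma isPreconnected_halfCircle (x : ℝ) {r : ℝ} (hr : 0 < r) :
    IsPreconnected {w : ℂ | 0 < w.im ∧ ‖w - x‖ = r} := by
  have h2 := (isPreconnected_Ioo (a := (0 : ℝ)) (b := Real.pi)).image (circleMap x r)
    (continuous_circleMap _ r).continuousOn
  convert h2 using 1
  have him : ∀ θ : ℝ, (circleMap x r θ).im = r * Real.sin θ := by
    intro θ
    rw [circleMap, exp_mul_I]
    simp [← ofReal_sin, ← ofReal_cos]
  ext w
  constructor
  · rintro ⟨hw, hwr⟩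
    obtain ⟨θ, hθ, rfl⟩ := exists_circleMap_eq (b := x) (w := w) (r := r)
      (by simpa [dist_eq_norm] using hwr)
    rw [him] at hw
    have hs := pos_of_mul_pos_right hw hr.le
    refine ⟨θ, ⟨?_, ?_⟩, rfl⟩
    · by_contra hneg
      exact not_lt.2 (Real.sin_nonpos_of_nonpos_of_neg_pi_le (not_lt.1 hneg) hθ.1.le) hs
    · refine lt_of_le_of_ne hθ.2 fun he => ?_
      rw [he, Real.sin_pi] at hs
      exact lt_irrefl _ hs
  · rintro ⟨θ, hθ, rfl⟩
    refine ⟨?_, by simp [abs_of_pos hr]⟩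
    rw [him]
    exact mul_pos hr (Real.sin_pos_of_pos_of_lt_pi hθ.1 hθ.2)

/-- The comparison estimate behind all uniform bounds: if `p` maps all of the finite boundary,
except for a part landing in a small disk around `x`, to finitely many horizontal lines, then the
mapping-out function `g` is uniformly close to `p`. -/
lemma MapOut.norm_sub_le_of_halfAnnulus {N : ℕ} {C : Fin N → Set ℂ} {F D' : Set ℂ}
    {g : ℂ → ℂ} (h : MapOut C F D' g) {p k : ℂ → ℂ} (hp : DifferentiableOn ℂ p (outDom C F))
    {x r₁ r₂ B η : ℝ} (hr₁ : 0 < r₁) (hr : r₁ < r₂) (hη : 0 < η)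
    (hk : DifferentiableOn ℂ k (halfAnnulus x r₁ r₂))
    (hkm : MapsTo k (halfAnnulus x r₁ r₂) (outDom C F))
    (hpk : ∀ w ∈ halfAnnulus x r₁ r₂, p (k w) = w)
    (hkp : ∀ z ∈ outDom C F, p z ∈ halfAnnulus x r₁ r₂ → k (p z) = z)
    (hpim : ∀ z ∈ outDom C F, 0 < (p z).im)
    (hpb : ∃ B', ∀ z ∈ outDom C F, ‖p z - z‖ ≤ B')
    (hB : ∀ z ∈ outDom C F, ‖g z - p z‖ ≤ B)
    (h0 : Tendsto (fun z => g z - p z) (cobounded ℂ ⊓ 𝓟 (outDom C F)) (𝓝 0))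
    (harea : 2 * Real.pi * (Real.pi * (r₂ + B) ^ 2) < η ^ 2 * Real.log (r₂ / r₁))
    {Y : Set ℝ} (hY : Y.Finite) (hY0 : 0 ∈ Y)
    (hbd : ∀ u : ℕ → ℂ, (∀ n, u n ∈ outDom C F) → ∀ z w, Tendsto u atTop (𝓝 z) →
      z ∉ outDom C F → Tendsto (fun n => p (u n)) atTop (𝓝 w) → w.im ∈ Y ∨ ‖w - x‖ ≤ r₁) :
    ∀ z ∈ outDom C F, ‖g z - p z‖ ≤ 2 * (2 * η + r₂) := by
  set E := halfAnnulus x r₁ r₂ with hE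
  have hr₂ : 0 < r₂ := hr₁.trans hr
  obtain ⟨B', hB'⟩ := hpb
  have hkc : ∀ r ∈ Ioo r₁ r₂, (x : ℂ) + r * I ∈ E ∧ ‖(x : ℂ) + r * I - x‖ = r := by
    intro r hr'
    have h1 : ‖(x : ℂ) + r * I - x‖ = r := by simp [abs_of_pos (hr₁.trans hr'.1)]
    refine ⟨⟨?_, ?_, ?_⟩, h1⟩
    · simpa using hr₁.trans hr'.1
    · rw [h1]; exact hr'.1
    · rw [h1]; exact hr'.2
  have hB0 : 0 ≤ B := by
    obtain ⟨r, hr'⟩ := exists_between hr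
    exact (norm_nonneg _).trans (hB _ (hkm (hkc r hr').1))
  have hgk : DifferentiableOn ℂ (g ∘ k) E := h.diff.comp hk hkm
  have hinj : InjOn (g ∘ k) E := by
    intro a ha b hb hab
    have := h.bij.injOn (hkm ha) (hkm hb) hab
    rw [← hpk a ha, ← hpk b hb, this]
  have hvol : volume ((g ∘ k) '' (E ∩ ball (x : ℂ) r₂)) ≤
      ENNReal.ofReal (Real.pi * (r₂ + B) ^ 2) := by
    have hsub : (g ∘ k) '' (E ∩ ball (x : ℂ) r₂) ⊆ closedBall (x : ℂ) (r₂ + B) := by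
      rintro _ ⟨w, ⟨hw, -⟩, rfl⟩
      rw [mem_closedBall, dist_eq_norm]
      have h1 := hB _ (hkm hw)
      rw [hpk w hw] at h1
      have h2 : g (k w) - x = (g (k w) - w) + (w - x) := by ring
      have h3 := norm_add_le (g (k w) - w) (w - x)
      rw [Function.comp_apply, h2]
      linarith [hw.2.2]
    refine (measure_mono hsub).trans (le_of_eq ?_)
    rw [Complex.volume_closedBall, mul_comm, ENNReal.ofReal_mul Real.pi_pos.le,
      ENNReal.ofReal_pow (by positivity)]
    congr 1
    rw [← NNReal.coe_real_pi, ENNReal.ofReal_coe_nnreal]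
  obtain ⟨r, hrr, hre, him⟩ := exists_circle_image_small (isOpen_halfAnnulus x r₁ r₂) hgk hinj hr₁
    hr hη hvol harea
  have hr0 : 0 < r := hr₁.trans hrr.1
  set Γ := (g ∘ k) '' {w : ℂ | 0 < w.im ∧ ‖w - x‖ = r} with hΓ
  have hcE : {w : ℂ | 0 < w.im ∧ ‖w - x‖ = r} ⊆ E := fun w hw =>
    ⟨hw.1, by rw [hw.2]; exact hrr.1, by rw [hw.2]; exact hrr.2⟩
  have hΓsub : Γ ⊆ (g ∘ k) '' (E ∩ sphere (x : ℂ) r) :=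
    image_mono fun w hw => ⟨hcE hw, by rw [mem_sphere, dist_eq_norm]; exact hw.2⟩
  have hΓp : IsPreconnected Γ :=
    (isPreconnected_halfCircle x hr0).image _ (hgk.continuousOn.mono hcE)
  have hΓre : ∀ a ∈ Γ, ∀ b ∈ Γ, a.re - b.re ≤ η := fun a ha b hb =>
    (hΓp.image _ continuous_re.continuousOn).sub_le_of_volume_le hη.le
      ((measure_mono (image_mono hΓsub)).trans hre) (mem_image_of_mem _ hb) (mem_image_of_mem _ ha)
  have hΓim : ∀ a ∈ Γ, ∀ b ∈ Γ, a.im - b.im ≤ η := fun a ha b hb =>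
    (hΓp.image _ continuous_im.continuousOn).sub_le_of_volume_le hη.le
      ((measure_mono (image_mono hΓsub)).trans him) (mem_image_of_mem _ hb) (mem_image_of_mem _ ha)
  obtain ⟨γ₀, hγ₀⟩ : Γ.Nonempty := ⟨_, x + r * I, ⟨(hkc r hrr).1.1, (hkc r hrr).2⟩, rfl⟩
  set R : Set ℂ := ⋂ γ ∈ Γ, Icc (γ.re - η) (γ.re + η) ×ℂ Icc (γ.im - η) (γ.im + η) with hRdef
  have hRc : IsClosed R := isClosed_biInter fun γ _ => (isCompact_rect _ _ _ _).isClosed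
  have hR : Convex ℝ R :=
    convex_iInter₂ fun γ _ => convex_reProdIm (convex_Icc _ _) (convex_Icc _ _)
  have hΓR : Γ ⊆ R := by
    intro a ha
    refine mem_iInter₂.2 fun b hb => ?_
    have h1 := hΓre a ha b hb
    have h2 := hΓre b hb a ha
    have h3 := hΓim a ha b hb
    have h4 := hΓim b hb a ha
    exact ⟨⟨by linarith, by linarith⟩, ⟨by linarith, by linarith⟩⟩
  have hRball : R ⊆ closedBall γ₀ (2 * η) := by
    intro q hq
    obtain ⟨⟨h1, h2⟩, h3, h4⟩ := mem_iInter₂.1 hq γ₀ hγ₀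
    rw [mem_closedBall, dist_eq_norm]
    refine (norm_le_abs_re_add_abs_im _).trans ?_
    have h5 : |(q - γ₀).re| ≤ η := by rw [sub_re, abs_le]; constructor <;> linarith
    have h6 : |(q - γ₀).im| ≤ η := by rw [sub_im, abs_le]; constructor <;> linarith
    linarith
  obtain ⟨Y₁, hY₁, hY₁0, hY₁'⟩ := h.target.exists_heights
  set V := outDom C F ∩ p ⁻¹' ball (x : ℂ) r with hV
  have hVo : IsOpen V := hp.continuousOn.isOpen_inter_preimage h.isOpen_dom isOpen_ball
  have hXo : IsOpen (g '' V) :=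
    isOpen_image_of_injOn h.diff h.bij.injOn hVo inter_subset_left
  have hXb : IsBounded (g '' V) := by
    refine isBounded_closedBall.subset (t := closedBall (x : ℂ) (B + r)) ?_
    rintro _ ⟨z, hz, rfl⟩
    have h1 := hB z hz.1
    have h2 : ‖p z - x‖ < r := by
      have : p z ∈ ball (x : ℂ) r := hz.2
      rwa [mem_ball, dist_eq_norm] at this
    rw [mem_closedBall, dist_eq_norm, show g z - x = (g z - p z) + (p z - x) by ring]
    exact (norm_add_le _ _).trans (by linarith)
  have hXR : g '' V ⊆ closedBall γ₀ (2 * η) := by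
    refine (subset_of_frontier hXo hXb hY₁ hRc hR fun q hq => ?_).trans hRball
    have hq2 : q ∉ g '' V := by have := hq.2; rwa [hXo.interior_eq] at this
    obtain ⟨v, hv, hvq⟩ := mem_closure_iff_seq_limit.1 hq.1
    choose u hu huv using hv
    have hgu : Tendsto (fun n => g (u n)) atTop (𝓝 q) := by simpa [huv] using hvq
    have hub : ∀ n, u n ∈ closedBall (x : ℂ) (B' + r) := by
      intro n
      have h1 := hB' _ (hu n).1
      have h2 : ‖p (u n) - x‖ < r := by
        have : p (u n) ∈ ball (x : ℂ) r := (hu n).2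
        rwa [mem_ball, dist_eq_norm] at this
      rw [mem_closedBall, dist_eq_norm, show u n - x = (p (u n) - x) - (p (u n) - u n) by ring]
      exact (norm_sub_le _ _).trans (by linarith)
    obtain ⟨z, -, φ, hφ, hz⟩ := tendsto_subseq_of_bounded isBounded_closedBall hub
    have hgz : Tendsto (fun n => g (u (φ n))) atTop (𝓝 q) := hgu.comp hφ.tendsto_atTop
    by_cases hzD : z ∈ outDom C F
    · right
      have hgz' := (h.diff.continuousOn.continuousAt (h.isOpen_dom.mem_nhds hzD)).tendsto.comp hz
      have hpz := (hp.continuousOn.continuousAt (h.isOpen_dom.mem_nhds hzD)).tendsto.comp hz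
      have hq : g z = q := tendsto_nhds_unique hgz' hgz
      have h1 : p z ∈ closedBall (x : ℂ) r := isClosed_closedBall.mem_of_tendsto hpz
        (Eventually.of_forall fun n => ball_subset_closedBall (hu (φ n)).2)
      have h2 : ‖p z - x‖ = r := by
        rw [mem_closedBall, dist_eq_norm] at h1
        refine le_antisymm h1 (not_lt.1 fun hlt => hq2 ⟨z, ⟨hzD, ?_⟩, hq⟩)
        rw [mem_preimage, mem_ball, dist_eq_norm]
        exact hlt
      have h3 : p z ∈ {w : ℂ | 0 < w.im ∧ ‖w - x‖ = r} := ⟨hpim z hzD, h2⟩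
      exact hΓR ⟨p z, h3, by rw [Function.comp_apply, hkp z hzD (hcE h3), hq]⟩
    · left
      exact hY₁' q (h.tendsto_not_mem_target (fun n => (hu (φ n)).1) hz hzD hgz)
        (h.tendsto_im_nonneg (fun n => (hu (φ n)).1) hgz)
  rcases eq_zero_or_mapsTo_of_boundary h.isOpen_dom h.isPreconnected_dom h.neBot
    (h.diff.sub hp) hB h0 (Y := image2 (fun a b => a - b) Y₁ Y) (hY₁.image2 _ hY)
    ⟨0, hY₁0, 0, hY0, sub_zero 0⟩ (R := closedBall (γ₀ - x) (2 * η + r₂)) isClosed_closedBall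
    (convex_closedBall _ _) (by
      intro u hu z q hz hzD hq
      have hpbd : ∀ᶠ n in atTop, p (u n) ∈ closedBall z (B' + 1) := by
        filter_upwards [hz.eventually (ball_mem_nhds z one_pos)] with n hn
        have h1 := hB' _ (hu n)
        rw [dist_eq_norm] at hn
        rw [mem_closedBall, dist_eq_norm, show p (u n) - z = (p (u n) - u n) + (u n - z) by ring]
        exact (norm_add_le _ _).trans (by linarith)
      obtain ⟨w, -, φ, hφ, hw⟩ :=
        tendsto_subseq_of_frequently_bounded isBounded_closedBall hpbd.frequently
      have hzφ := hz.comp hφ.tendsto_atTop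
      have hg : Tendsto (fun n => g (u (φ n))) atTop (𝓝 (q + w)) := by
        refine ((hq.comp hφ.tendsto_atTop).add hw).congr fun n => ?_
        simp
      rcases hbd (u ∘ φ) (fun n => hu _) z w hzφ hzD hw with hwY | hwx
      · left
        exact ⟨(q + w).im, hY₁' _ (h.tendsto_not_mem_target (fun n => hu (φ n)) hzφ hzD hg)
          (h.tendsto_im_nonneg (fun n => hu (φ n)) hg), w.im, hwY, by simp⟩
      · right
        have hwb : w ∈ ball (x : ℂ) r := by
          rw [mem_ball, dist_eq_norm]; exact hwx.trans_lt hrr.1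
        have h1 : q + w ∈ closedBall γ₀ (2 * η) := isClosed_closedBall.mem_of_tendsto hg (by
          filter_upwards [hw.eventually (isOpen_ball.mem_nhds hwb)] with n hn
            using hXR ⟨_, ⟨hu _, hn⟩, rfl⟩)
        rw [mem_closedBall, dist_eq_norm] at h1 ⊢
        rw [show q - (γ₀ - x) = (q + w - γ₀) - (w - x) by ring]
        exact (norm_sub_le _ _).trans (by linarith)) with hz | ⟨hm, hz⟩
  · intro z hzD
    have := hz z hzD
    simp only [Pi.sub_apply] at this
    rw [this, norm_zero]
    positivity
  · intro z hzD
    have h1 := hm z hzD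
    rw [mem_closedBall, dist_eq_norm] at h1 hz
    rw [zero_sub, norm_neg] at hz
    simp only [Pi.sub_apply] at h1
    rw [show g z - p z = (g z - p z - (γ₀ - x)) + (γ₀ - x) by ring]
    exact (norm_add_le _ _).trans (by linarith)

namespace MapOut

variable {N : ℕ} {C : Fin N → Set ℂ} {F D' : Set ℂ} {g : ℂ → ℂ}

lemma dom_nonempty (h : MapOut C F D' g) : (outDom C F).Nonempty := by
  have := h.neBot
  exact nonempty_of_mem (mem_inf_of_right (mem_principal_self _) :
    outDom C F ∈ cobounded ℂ ⊓ 𝓟 (outDom C F))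

/-- A bound for `g z - z` depending only on the size of the hull and of the slits. -/
lemma norm_sub_self_le (h : MapOut C F D' g) {r : ℝ} (hr : 0 < r) (hF : F ⊆ closedBall 0 r)
    (hC : ⋃ j, C j ⊆ closedBall 0 r) :
    ∀ z ∈ outDom C F, ‖g z - z‖ ≤ 3 * (r * Real.exp 6000) := by
  obtain ⟨B₀, hB₀⟩ := h.exists_bound
  set S := (fun z => ‖g z - z‖) '' outDom C F with hS
  have hSn : S.Nonempty := h.dom_nonempty.image _
  have hSb : BddAbove S := ⟨B₀, by rintro _ ⟨z, hz, rfl⟩; exact hB₀ z hz⟩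
  have hle : ∀ z ∈ outDom C F, ‖g z - z‖ ≤ sSup S := fun z hz =>
    le_csSup hSb (mem_image_of_mem _ hz)
  have hB0 : 0 ≤ sSup S := by
    obtain ⟨z, hz⟩ := h.dom_nonempty
    exact (norm_nonneg _).trans (hle z hz)
  set B := sSup S
  set r₂ := r * Real.exp 6000 with hr₂
  have hr₂0 : 0 < r₂ := by positivity
  have hrr : r < r₂ := by
    have : 1 < Real.exp 6000 := Real.one_lt_exp_iff.2 (by norm_num)
    nlinarith
  have hsub : halfAnnulus 0 r r₂ ⊆ outDom C F := by
    rintro w ⟨h1, h2, -⟩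
    have h3 : w ∉ closedBall (0 : ℂ) r := by simpa using h2
    exact ⟨⟨h1, fun hw => h3 (hC hw)⟩, fun hw => h3 (hF hw)⟩
  have key := h.norm_sub_le_of_halfAnnulus (p := fun z => z) (k := fun z => z) (x := 0)
    (r₁ := r) (r₂ := r₂) (B := B) (η := (r₂ + B) / 16) differentiableOn_id hr hrr (by positivity)
    differentiableOn_id hsub (fun _ _ => rfl) (fun _ _ _ => rfl) (fun z hz => hz.1.1)
    ⟨0, by simp⟩ hle h.norm (by
      rw [hr₂, mul_div_cancel_left₀ _ hr.ne', Real.log_exp, ← hr₂]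
      have h1 := Real.pi_lt_d2
      have h2 := Real.pi_pos
      have h3 : 0 < (r₂ + B) ^ 2 := by positivity
      have h4 : Real.pi ^ 2 < 9.93 := by nlinarith
      nlinarith) (Y := {0}) (finite_singleton 0) rfl (by
      intro u hu z w hz hzD hw
      have hzw : z = w := tendsto_nhds_unique hz hw
      subst hzw
      have him : 0 ≤ z.im := isClosed_Ici.mem_of_tendsto
        ((continuous_im.tendsto z).comp hz)
        (Eventually.of_forall fun n => show 0 ≤ (u n).im from le_of_lt (hu n).1.1)
      rcases him.eq_or_lt with h0 | h0
      · left; exact h0.symm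
      · right
        by_contra hn
        have h3 : z ∉ closedBall (0 : ℂ) r := by simpa using hn
        exact hzD ⟨⟨h0, fun hw => h3 (hC hw)⟩, fun hw => h3 (hF hw)⟩)
  have hB : B ≤ 2 * (2 * ((r₂ + B) / 16) + r₂) := csSup_le hSn (by
    rintro _ ⟨z, hz, rfl⟩; exact key z hz)
  intro z hz
  have := hle z hz
  linarith

variable {F₁ D₁ : Set ℂ} {g₁ : ℂ → ℂ}

lemma dom_anti (hF : F ⊆ F₁) : outDom C F₁ ⊆ outDom C F := sdiff_subset_sdiff_right hF

lemma tendsto_sub (h : MapOut C F D' g) (h₁ : MapOut C F₁ D₁ g₁) (hF : F ⊆ F₁) :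
    Tendsto (fun z => g₁ z - g z) (cobounded ℂ ⊓ 𝓟 (outDom C F₁)) (𝓝 0) := by
  have := h₁.norm.sub (h.norm.mono_left (inf_le_inf_left _ (principal_mono.2 (dom_anti hF))))
  simpa using this

/-- Mapping-out functions of larger hulls have smaller imaginary part. -/
lemma im_le_im (h : MapOut C F D' g) (h₁ : MapOut C F₁ D₁ g₁) (hF : F ⊆ F₁) :
    ∀ z ∈ outDom C F₁, (g₁ z).im ≤ (g z).im := by
  obtain ⟨B, hB⟩ := h.exists_bound
  obtain ⟨B₁, hB₁⟩ := h₁.exists_bound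
  obtain ⟨Y, hY, hY0, hY'⟩ := h.target.exists_heights
  obtain ⟨Y₁, hY₁, hY₁0, hY₁'⟩ := h₁.target.exists_heights
  have hsub := dom_anti (C := C) hF
  rcases eq_zero_or_mapsTo_of_boundary h₁.isOpen_dom h₁.isPreconnected_dom h₁.neBot
    (f := fun z => g₁ z - g z) (h₁.diff.sub (h.diff.mono hsub)) (B := B₁ + B) (by
      intro z hz
      rw [show g₁ z - g z = (g₁ z - z) - (g z - z) by ring]
      exact (norm_sub_le _ _).trans (add_le_add (hB₁ z hz) (hB z (hsub hz))))
    (h.tendsto_sub h₁ hF) (Y := image2 (fun a b => a - b) Y₁ Y) (hY₁.image2 _ hY)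
    ⟨0, hY₁0, 0, hY0, sub_zero 0⟩ (R := {w : ℂ | w.im ≤ 0})
    (isClosed_le continuous_im continuous_const) (convex_halfSpace_im_le 0) (by
      intro u hu z q hz hzD hq
      have hpbd : ∀ᶠ n in atTop, g (u n) ∈ closedBall z (B + 1) := by
        filter_upwards [hz.eventually (ball_mem_nhds z one_pos)] with n hn
        have h1 := hB _ (hsub (hu n))
        rw [dist_eq_norm] at hn
        rw [mem_closedBall, dist_eq_norm, show g (u n) - z = (g (u n) - u n) + (u n - z) by ring]
        exact (norm_add_le _ _).trans (by linarith)
      obtain ⟨w, -, φ, hφ, hw⟩ :=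
        tendsto_subseq_of_frequently_bounded isBounded_closedBall hpbd.frequently
      have hzφ := hz.comp hφ.tendsto_atTop
      have hg : Tendsto (fun n => g₁ (u (φ n))) atTop (𝓝 (q + w)) := by
        refine ((hq.comp hφ.tendsto_atTop).add hw).congr fun n => ?_
        simp
      have hwim : 0 ≤ w.im := h.tendsto_im_nonneg (fun n => hsub (hu (φ n))) hw
      by_cases hzF : z ∈ outDom C F
      · right
        have : (q + w).im = 0 := h₁.boundary_im_eq_zero (fun n => hu (φ n)) hzφ
          (fun hz' => hzD ⟨hzF.1, hz'.2⟩) hg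
        rw [add_im] at this
        show q.im ≤ 0
        linarith
      · left
        exact ⟨(q + w).im, hY₁' _ (h₁.tendsto_not_mem_target (fun n => hu (φ n)) hzφ hzD hg)
          (h₁.tendsto_im_nonneg (fun n => hu (φ n)) hg), w.im,
          hY' _ (h.tendsto_not_mem_target (fun n => hsub (hu (φ n))) hzφ hzF hw) hwim, by simp⟩)
    with hz | ⟨hm, -⟩
  · intro z hzD
    rw [sub_eq_zero.1 (hz z hzD)]
  · intro z hzD
    have : (g₁ z - g z).im ≤ 0 := hm z hzD
    rw [sub_im] at this
    linarith

/-- A lower bound for the slit heights that only depends on the largest hull. -/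
lemma mem_target_of_im_lt (h : MapOut C F D' g) (h₁ : MapOut C F₁ D₁ g₁) (hF : F ⊆ F₁) {m : ℝ}
    (hm : ∀ p ∈ ⋃ j, C j, ∀ᶠ z in 𝓝[outDom C F₁] p, m ≤ (g₁ z).im) {w : ℂ} (hw0 : 0 < w.im)
    (hwm : w.im < m) : w ∈ D' := by
  by_contra hwD
  obtain ⟨B, hB⟩ := h.exists_bound
  obtain ⟨Y, hY, hY0, hY'⟩ := h.target.exists_heights
  obtain ⟨k, hkd, hkm, hgk, hkg⟩ := h.exists_inverse
  have hcl : w ∈ closure D' := by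
    refine closure_mono ?_ (mem_closure_im_not_mem isOpen_UHP hY (show w ∈ UHP from hw0))
    rintro z ⟨hz, hzY⟩
    by_contra hzD
    exact hzY (hY' z hzD (le_of_lt hz))
  obtain ⟨v, hv, hvw⟩ := mem_closure_iff_seq_limit.1 hcl
  have hub : ∀ᶠ n in atTop, k (v n) ∈ closedBall w (B + 1) := by
    filter_upwards [hvw.eventually (ball_mem_nhds w one_pos)] with n hn
    have h1 := hB _ (hkm (hv n))
    rw [hgk _ (hv n)] at h1
    rw [dist_eq_norm] at hn
    rw [mem_closedBall, dist_eq_norm, show k (v n) - w = (v n - w) - (v n - k (v n)) by ring]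
    exact (norm_sub_le _ _).trans (by linarith)
  obtain ⟨z, -, φ, hφ, hz⟩ :=
    tendsto_subseq_of_frequently_bounded isBounded_closedBall hub.frequently
  have hu : ∀ n, k (v (φ n)) ∈ outDom C F := fun n => hkm (hv _)
  have hgu : Tendsto (fun n => g (k (v (φ n)))) atTop (𝓝 w) := by
    refine (hvw.comp hφ.tendsto_atTop).congr fun n => ?_
    rw [hgk _ (hv _)]; rfl
  have hzF : z ∈ UHP \ F := by
    by_contra hzF
    exact hw0.ne' (h.boundary_im_eq_zero hu hz hzF hgu)
  have hzD : z ∉ outDom C F := h.tendsto_not_mem_dom hz hgu hwD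
  have hzC : z ∈ ⋃ j, C j := by
    by_contra hzC
    exact hzD ⟨⟨hzF.1, hzC⟩, hzF.2⟩
  have hzF₁ : z ∉ closure F₁ := fun hz' => disjoint_left.1 h₁.cldisj hz' hzC
  have hev : ∀ᶠ n in atTop, k (v (φ n)) ∈ outDom C F₁ := by
    filter_upwards [hz.eventually (isClosed_closure.isOpen_compl.mem_nhds hzF₁)] with n hn
    exact ⟨(hu n).1, fun hn' => hn (subset_closure hn')⟩
  have h1 : Tendsto (fun n => k (v (φ n))) atTop (𝓝[outDom C F₁] z) :=
    tendsto_nhdsWithin_iff.2 ⟨hz, hev⟩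
  have h2 : m ≤ w.im := isClosed_Ici.mem_of_tendsto ((continuous_im.tendsto w).comp hgu) (by
    filter_upwards [h1.eventually (hm z hzC), hev] with n hn hn'
    exact hn.trans (h.im_le_im h₁ hF _ hn'))
  linarith

/-- Mapping-out functions of nested hulls are close if the image of the difference is small. -/
lemma norm_sub_le_of_image_subset (h : MapOut C F D' g) (h₁ : MapOut C F₁ D₁ g₁) (hF : F ⊆ F₁)
    {x r₁ r₂ B η : ℝ} (hr₁ : 0 < r₁) (hr : r₁ < r₂) (hη : 0 < η)
    (hD' : ∀ w : ℂ, 0 < w.im → w.im < r₂ → w ∈ D')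
    (himg : g '' (F₁ \ F) ⊆ closedBall (x : ℂ) r₁)
    (hB : ∀ z ∈ outDom C F₁, ‖g₁ z - g z‖ ≤ B)
    (harea : 2 * Real.pi * (Real.pi * (r₂ + B) ^ 2) < η ^ 2 * Real.log (r₂ / r₁)) :
    ∀ z ∈ outDom C F₁, ‖g₁ z - g z‖ ≤ 2 * (2 * η + r₂) := by
  obtain ⟨B', hB'⟩ := h.exists_bound
  obtain ⟨Y, hY, hY0, hY'⟩ := h.target.exists_heights
  obtain ⟨k, hkd, hkm, hgk, hkg⟩ := h.exists_inverse
  have hsub := dom_anti (C := C) hF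
  have hE : halfAnnulus x r₁ r₂ ⊆ D' := by
    rintro w ⟨h1, -, h2⟩
    refine hD' w h1 (lt_of_le_of_lt ?_ h2)
    have := abs_im_le_norm (w - x)
    rw [sub_im, ofReal_im, sub_zero] at this
    exact (le_abs_self _).trans this
  refine h₁.norm_sub_le_of_halfAnnulus (h.diff.mono hsub) hr₁ hr hη (hkd.mono hE) ?_
    (fun w hw => hgk w (hE hw)) (fun z hz _ => hkg z (hsub hz))
    (fun z hz => h.target.im_pos (h.bij.mapsTo (hsub hz))) ⟨B', fun z hz => hB' z (hsub hz)⟩ hB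
    (h.tendsto_sub h₁ hF) harea hY hY0 ?_
  · intro w hw
    have h1 := hkm (hE hw)
    refine ⟨h1.1, fun h2 => ?_⟩
    have h3 := himg (mem_image_of_mem g ⟨h2, h1.2⟩)
    rw [hgk w (hE hw), mem_closedBall, dist_eq_norm] at h3
    exact absurd h3 (not_le.2 hw.2.1)
  · intro u hu z w hz hzD hw
    by_cases hzF : z ∈ outDom C F
    · right
      have h1 := (h.diff.continuousOn.continuousAt (h.isOpen_dom.mem_nhds hzF)).tendsto.comp hz
      have h2 : g z = w := tendsto_nhds_unique h1 hw
      have h3 : z ∈ F₁ \ F := ⟨by by_contra h4; exact hzD ⟨hzF.1, h4⟩, hzF.2⟩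
      have h4 := himg (mem_image_of_mem g h3)
      rwa [h2, mem_closedBall, dist_eq_norm] at h4
    · left
      exact hY' w (h.tendsto_not_mem_target (fun n => hsub (hu n)) hz hzF hw)
        (h.tendsto_im_nonneg (fun n => hsub (hu n)) hw)

end MapOut

lemma eventually_lt_mul_log {ρ η : ℝ} (hρ : 0 < ρ) (hη : 0 < η) (A : ℝ) :
    ∀ᶠ ε in 𝓝[>] (0 : ℝ), A < η ^ 2 * Real.log (ρ / ε) := by
  have h1 : Tendsto (fun ε : ℝ => ρ / ε) (𝓝[>] 0) atTop := by
    simpa [div_eq_mul_inv] using (tendsto_inv_nhdsGT_zero (𝕜 := ℝ)).const_mul_atTop hρ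
  exact ((Real.tendsto_log_atTop.comp h1).const_mul_atTop (by positivity :
    0 < η ^ 2)).eventually_gt_atTop A

namespace MapOut

variable {N : ℕ} {C : Fin N → Set ℂ} {F D' : Set ℂ} {g : ℂ → ℂ}

/-- If `g` maps a cross-cut into a disk then sets separated by it from infinity are mapped into
the same disk. -/
lemma image_subset_closedBall_of_separates (h : MapOut C F D' g) {K S : Set ℂ} {x r : ℝ}
    (hS : S ⊆ outDom C F) (hsep : SeparatesFromInfty (outDom C F) K S)
    (hK : ∀ z ∈ K ∩ outDom C F, g z ∈ closedBall (x : ℂ) r) :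
    g '' S ⊆ closedBall (x : ℂ) r := by
  rintro _ ⟨z, hz, rfl⟩
  by_contra hzb
  obtain ⟨B, hB⟩ := h.exists_bound
  obtain ⟨Y, hY, hY0, hY'⟩ := h.target.exists_heights
  obtain ⟨k, hkd, hkm, hgk, hkg⟩ := h.exists_inverse
  have hzG := hS hz
  have hzK : z ∉ K := fun hzK => hzb (hK z ⟨hzK, hzG⟩)
  have hOo : IsOpen (D' \ closedBall (x : ℂ) r) := h.target.isOpen.sdiff isClosed_closedBall
  obtain ⟨δ, hδ, hball⟩ := Metric.isOpen_iff.1 hOo (g z) ⟨h.bij.mapsTo hzG, hzb⟩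
  obtain ⟨w, ⟨hw, hwY⟩⟩ : {w ∈ ball (g z) δ | w.im ∉ Y}.Nonempty :=
    closure_nonempty_iff.1 ⟨_, mem_closure_im_not_mem isOpen_ball hY (mem_ball_self hδ)⟩
  obtain ⟨σ, hσ, hσw⟩ : ∃ σ : ℝ, |σ| = 1 ∧ 0 ≤ σ * (w.re - x) := by
    rcases le_total 0 (w.re - x) with h1 | h1
    · exact ⟨1, by simp, by simpa using h1⟩
    · exact ⟨-1, by simp, by simpa using h1⟩
  have hσ2 : σ ^ 2 = 1 := by rw [← sq_abs, hσ, one_pow]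
  set ray : ℝ → ℂ := fun t => w + (σ * t : ℝ) with hray
  have hrayD : ∀ t ∈ Ici (0 : ℝ), ray t ∈ D' \ closedBall (x : ℂ) r := by
    intro t ht
    have ht0 : 0 ≤ t := ht
    have him : (ray t).im = w.im := by simp [hray]
    have hwD := hball hw
    refine ⟨?_, ?_⟩
    · by_contra hn
      refine hwY ?_
      rw [← him]
      exact hY' _ hn (by rw [him]; exact (h.target.im_pos hwD.1).le)
    · have h1 : r < ‖w - x‖ := by simpa [dist_eq_norm] using hwD.2
      rw [mem_closedBall, dist_eq_norm, not_le]
      refine h1.trans_le (le_of_sq_le_sq ?_ (norm_nonneg _))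
      rw [← normSq_eq_norm_sq, ← normSq_eq_norm_sq, normSq_apply, normSq_apply]
      simp only [hray, sub_re, sub_im, add_re, add_im, ofReal_re, ofReal_im]
      nlinarith [mul_nonneg hσw ht0]
  set L := ball (g z) δ ∪ ray '' Ici 0 with hL
  have hLp : IsPreconnected L := by
    refine IsPreconnected.union w hw ⟨0, mem_Ici.2 le_rfl, by simp [hray]⟩
      (convex_ball _ _).isPreconnected ((convex_Ici 0).isPreconnected.image _ ?_)
    exact Continuous.continuousOn (by fun_prop)
  have hLD : L ⊆ D' \ closedBall (x : ℂ) r :=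
    union_subset hball (by rintro _ ⟨t, ht, rfl⟩; exact hrayD t ht)
  have hkL : IsPreconnected (k '' L) :=
    hLp.image _ (hkd.continuousOn.mono fun w hw => (hLD hw).1)
  have hkLs : k '' L ⊆ outDom C F \ K := by
    rintro _ ⟨l, hl, rfl⟩
    have h1 := hkm (hLD hl).1
    refine ⟨h1, fun h2 => (hLD hl).2 ?_⟩
    have := hK _ ⟨h2, h1⟩
    rwa [hgk l (hLD hl).1] at this
  have hcomp := hkL.subset_connectedComponentIn (x := z)
    ⟨g z, Or.inl (mem_ball_self hδ), hkg z hzG⟩ hkLs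
  obtain ⟨M, hM⟩ := ((hsep z ⟨hz, hzG, hzK⟩).subset hcomp).exists_norm_le
  set t := M + B + ‖w‖ + 1 with ht
  have ht1 : |t| ≤ ‖ray t‖ + ‖w‖ := by
    have h1 : ((σ * t : ℝ) : ℂ) = ray t - w := by simp [hray]
    have h2 := norm_sub_le (ray t) w
    rw [← h1, norm_real, Real.norm_eq_abs, abs_mul, hσ, one_mul] at h2
    exact h2
  have hM0 : 0 ≤ M := (norm_nonneg _).trans
    (hM _ (mem_image_of_mem k (Or.inl (mem_ball_self hδ))))
  have hB0 : 0 ≤ B := (norm_nonneg _).trans (hB z hzG)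
  have ht0 : 0 ≤ t := by positivity
  have hrt : ray t ∈ L := Or.inr (mem_image_of_mem _ ht0)
  have h1 := hM _ (mem_image_of_mem k hrt)
  have h2 := hB _ (hkm (hLD hrt).1)
  rw [hgk _ (hLD hrt).1] at h2
  have h3 := norm_add_le (ray t - k (ray t)) (k (ray t))
  rw [sub_add_cancel] at h3
  rw [abs_of_nonneg ht0] at ht1
  linarith

/-- A short cross-cut that starts away from the slits is mapped into a small disk. -/
lemma image_crossCut_subset (h : MapOut C F D' g) {M ε ρ η : ℝ}
    (hM : ∀ z ∈ outDom C F, ‖g z - z‖ ≤ M) (hε : 0 < ε) (hερ : ε < ρ) (hη : 0 < η)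
    (harea : 2 * Real.pi * (Real.pi * (ρ + M) ^ 2) < η ^ 2 * Real.log (ρ / ε))
    {c : ℝ → ℂ} (hc : ContinuousOn c (Icc 0 1)) (hc0 : c 0 ∉ outDom C F)
    (hc01 : c '' Ioo 0 1 ⊆ outDom C F) (hcε : ∀ s ∈ Icc (0 : ℝ) 1, dist (c s) (c 0) < ε)
    (hρ : Disjoint (ball (c 0) ρ) (⋃ j, C j)) :
    ∃ x : ℝ, g '' (c '' Ioo 0 1) ⊆ closedBall (x : ℂ) (2 * η) := by
  have hM0 : 0 ≤ M := by
    obtain ⟨z, hz⟩ := h.dom_nonempty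
    exact (norm_nonneg _).trans (hM z hz)
  set G := outDom C F with hG
  set b := c 0 with hb
  have hnot : ∀ z ∈ ball b ρ, z ∉ G → z ∉ UHP \ F := fun z hz hzG hzF =>
    hzG ⟨⟨hzF.1, disjoint_left.1 hρ hz⟩, hzF.2⟩
  have hρ0 : 0 < ρ := hε.trans hερ
  have hvol : volume (g '' (G ∩ ball b ρ)) ≤ ENNReal.ofReal (Real.pi * (ρ + M) ^ 2) := by
    have hsub : g '' (G ∩ ball b ρ) ⊆ closedBall b (ρ + M) := by
      rintro _ ⟨z, ⟨hz, hzb⟩, rfl⟩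
      have h1 := hM z hz
      rw [mem_ball, dist_eq_norm] at hzb
      rw [mem_closedBall, dist_eq_norm, show g z - b = (g z - z) + (z - b) by ring]
      exact (norm_add_le _ _).trans (by linarith)
    refine (measure_mono hsub).trans (le_of_eq ?_)
    rw [Complex.volume_closedBall, mul_comm, ENNReal.ofReal_mul Real.pi_pos.le,
      ENNReal.ofReal_pow (by positivity)]
    congr 1
    rw [← NNReal.coe_real_pi, ENNReal.ofReal_coe_nnreal]
  obtain ⟨r, hr, hre, him⟩ := exists_circle_image_small h.isOpen_dom h.diff h.bij.injOn hε hερ hη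
    hvol harea
  set Γ := g '' (G ∩ sphere b r) with hΓ
  have hcV : c '' Ioo 0 1 ⊆ G ∩ ball b r := by
    rintro _ ⟨s, hs, rfl⟩
    exact ⟨hc01 (mem_image_of_mem _ hs), (hcε s (Ioo_subset_Icc_self hs)).trans hr.1⟩
  have hmid : (1 / 2 : ℝ) ∈ Ioo (0 : ℝ) 1 := by norm_num
  have hVo : IsOpen (G ∩ ball b r) := h.isOpen_dom.inter isOpen_ball
  set Ω := connectedComponentIn (G ∩ ball b r) (c (1 / 2)) with hΩ
  have hΩo : IsOpen Ω := hVo.connectedComponentIn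
  have hΩV : Ω ⊆ G ∩ ball b r := connectedComponentIn_subset _ _
  have hΩp : IsPreconnected Ω := isPreconnected_connectedComponentIn
  have hcΩ : c '' Ioo 0 1 ⊆ Ω :=
    (isPreconnected_Ioo.image _ (hc.mono Ioo_subset_Icc_self)).subset_connectedComponentIn
      (mem_image_of_mem _ hmid) hcV
  have hΩG : Ω ⊆ G := hΩV.trans inter_subset_left
  have hXo : IsOpen (g '' Ω) := isOpen_image_of_injOn h.diff h.bij.injOn hΩo hΩG
  have hXp : IsPreconnected (g '' Ω) := hΩp.image _ (h.diff.continuousOn.mono hΩG)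
  have hXb' : g '' Ω ⊆ closedBall b (r + M) := by
    rintro _ ⟨z, hz, rfl⟩
    have h1 := hM z (hΩG hz)
    have h2 : z ∈ ball b r := (hΩV hz).2
    rw [mem_ball, dist_eq_norm] at h2
    rw [mem_closedBall, dist_eq_norm, show g z - b = (g z - z) + (z - b) by ring]
    exact (norm_add_le _ _).trans (by linarith)
  have hXb : IsBounded (g '' Ω) := isBounded_closedBall.subset hXb'
  have hXim : ∀ q ∈ g '' Ω, 0 < q.im := by
    rintro _ ⟨z, hz, rfl⟩
    exact h.im_pos (hΩG hz)
  have hfr : ∀ q ∈ frontier (g '' Ω), q.im ≠ 0 → q ∈ Γ := by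
    intro q hq hq0
    have hq2 : q ∉ g '' Ω := by have := hq.2; rwa [hXo.interior_eq] at this
    obtain ⟨v, hv, hvq⟩ := mem_closure_iff_seq_limit.1 hq.1
    choose u hu huv using hv
    have hgu : Tendsto (fun n => g (u n)) atTop (𝓝 q) := by simpa [huv] using hvq
    obtain ⟨z, hzcl, φ, hφ, hz⟩ := tendsto_subseq_of_bounded
      (isBounded_ball.subset (hΩV.trans inter_subset_right)) hu
    have hgz : Tendsto (fun n => g (u (φ n))) atTop (𝓝 q) := hgu.comp hφ.tendsto_atTop
    have hzb : z ∈ closedBall b r := closure_ball_subset_closedBall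
      (closure_mono (hΩV.trans inter_subset_right) hzcl)
    have hzρ : z ∈ ball b ρ := (mem_closedBall.1 hzb).trans_lt hr.2
    have hzG : z ∈ G := by
      by_contra hzG
      exact hq0 (h.boundary_im_eq_zero (fun n => hΩG (hu (φ n))) hz (hnot z hzρ hzG) hgz)
    have hgz' := (h.diff.continuousOn.continuousAt (h.isOpen_dom.mem_nhds hzG)).tendsto.comp hz
    have hq : g z = q := tendsto_nhds_unique hgz' hgz
    refine ⟨z, ⟨hzG, ?_⟩, hq⟩
    rw [mem_sphere]
    refine le_antisymm hzb (not_lt.1 fun hlt => hq2 ⟨z, ?_, hq⟩)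
    have hzV : z ∈ G ∩ ball b r := ⟨hzG, hlt⟩
    have hpre : IsPreconnected (insert z Ω) :=
      hΩp.subset_closure (subset_insert _ _) (insert_subset hzcl subset_closure)
    exact hpre.subset_connectedComponentIn (mem_insert_of_mem _ (hcΩ (mem_image_of_mem _ hmid)))
      (insert_subset hzV hΩV) (mem_insert _ _)
  have exit : ∀ (d : ℂ), ‖d‖ = 1 → 0 ≤ d.im → ∀ q ∈ g '' Ω, ∃ t : ℝ, q + t * d ∈ Γ := by
    intro d hd hdi q hq
    obtain ⟨R, hR⟩ := hXb.exists_norm_le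
    have hpre : IsPreconnected ((fun t : ℝ => q + t * d) '' Ici 0) :=
      (convex_Ici 0).isPreconnected.image _ (Continuous.continuousOn (by fun_prop))
    obtain ⟨_, ⟨t, ht, rfl⟩, hq'⟩ := hpre.inter_frontier_nonempty_of_isOpen hXo
      ⟨q, ⟨0, mem_Ici.2 le_rfl, by simp⟩, hq⟩ (fun hsub => by
        have hR0 := (norm_nonneg q).trans (hR q hq)
        have h1 := hR _ (hsub (mem_image_of_mem _ (show 2 * R + 1 ∈ Ici (0 : ℝ) by
          simp only [mem_Ici]; linarith)))
        have h2 := hR q hq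
        have h3 := norm_sub_le (q + ((2 * R + 1 : ℝ) : ℂ) * d) q
        rw [add_sub_cancel_left, norm_mul, hd, mul_one, norm_real, Real.norm_eq_abs] at h3
        have h4 := le_abs_self (2 * R + 1)
        linarith)
    refine ⟨t, hfr _ hq' ?_⟩
    have ht0 : 0 ≤ t := ht
    have := hXim q hq
    simp only [add_im, im_ofReal_mul]
    nlinarith [mul_nonneg ht0 hdi]
  have hreX : re '' (g '' Ω) ⊆ re '' Γ := by
    rintro _ ⟨q, hq, rfl⟩
    obtain ⟨t, ht⟩ := exit I (by simp) (by simp) q hq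
    exact ⟨_, ht, by simp⟩
  have himX : im '' (g '' Ω) ⊆ im '' Γ := by
    rintro _ ⟨q, hq, rfl⟩
    obtain ⟨t, ht⟩ := exit 1 (by simp) (by simp) q hq
    exact ⟨_, ht, by simp⟩
  have hwre : ∀ p ∈ g '' Ω, ∀ q ∈ g '' Ω, q.re - p.re ≤ η := fun p hp q hq =>
    (hXp.image _ continuous_re.continuousOn).sub_le_of_volume_le hη.le
      ((measure_mono hreX).trans hre) (mem_image_of_mem _ hp) (mem_image_of_mem _ hq)
  have hwim : ∀ p ∈ g '' Ω, ∀ q ∈ g '' Ω, q.im - p.im ≤ η := fun p hp q hq =>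
    (hXp.image _ continuous_im.continuousOn).sub_le_of_volume_le hη.le
      ((measure_mono himX).trans him) (mem_image_of_mem _ hp) (mem_image_of_mem _ hq)
  have him0 : ∀ q ∈ g '' Ω, q.im ≤ η := by
    set s : ℕ → ℝ := fun n => 1 / ((n : ℝ) + 2) with hs
    have hs01 : ∀ n, s n ∈ Ioo (0 : ℝ) 1 := by
      intro n
      refine ⟨by positivity, ?_⟩
      rw [hs, div_lt_one (by positivity)]
      linarith [n.cast_nonneg (α := ℝ)]
    have hs0 : Tendsto s atTop (𝓝[Icc 0 1] 0) := by
      refine tendsto_nhdsWithin_iff.2 ⟨?_, Eventually.of_forall fun n =>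
        Ioo_subset_Icc_self (hs01 n)⟩
      exact tendsto_const_nhds.div_atTop
        (tendsto_atTop_add_const_right _ _ tendsto_natCast_atTop_atTop)
    have hcs : Tendsto (fun n => c (s n)) atTop (𝓝 b) :=
      (hc 0 (by simp)).tendsto.comp hs0
    have hu : ∀ n, c (s n) ∈ Ω := fun n => hcΩ (mem_image_of_mem _ (hs01 n))
    obtain ⟨w, -, φ, hφ, hw⟩ := tendsto_subseq_of_bounded hXb
      (fun n => mem_image_of_mem g (hu n))
    have hw0 : w.im = 0 := h.boundary_im_eq_zero (fun n => hΩG (hu (φ n)))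
      (hcs.comp hφ.tendsto_atTop) (hnot b (mem_ball_self hρ0) hc0) hw
    intro q hq
    have h1 : Tendsto (fun n => q.im - (g (c (s (φ n)))).im) atTop (𝓝 (q.im - w.im)) :=
      tendsto_const_nhds.sub ((continuous_im.tendsto w).comp hw)
    have h2 := le_of_tendsto h1 (Eventually.of_forall fun n =>
      hwim _ (mem_image_of_mem g (hu (φ n))) q hq)
    linarith
  have hp₀ : g (c (1 / 2)) ∈ g '' Ω := mem_image_of_mem _ (hcΩ (mem_image_of_mem _ hmid))
  refine ⟨(g (c (1 / 2))).re, (image_mono hcΩ).trans fun q hq => ?_⟩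
  rw [mem_closedBall, dist_eq_norm]
  refine (norm_le_abs_re_add_abs_im _).trans ?_
  have h1 := hwre _ hp₀ q hq
  have h2 := hwre q hq _ hp₀
  have h3 := him0 q hq
  have h4 := hXim q hq
  have h5 : |(q - ((g (c (1 / 2))).re : ℂ)).re| ≤ η := by
    rw [sub_re, ofReal_re, abs_le]; constructor <;> linarith
  have h6 : |(q - ((g (c (1 / 2))).re : ℂ)).im| ≤ η := by
    rw [sub_im, ofReal_im, sub_zero, abs_le]; constructor <;> linarith
  linarith

end MapOut

lemma exists_slit_nhd {N : ℕ} {C : Fin N → Set ℂ} (hC : ∀ j, IsHorizontalSlit (C j))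
    (hd : Pairwise fun i j => Disjoint (C i) (C j)) {E : Set ℂ} (hE : IsClosed E)
    (hEC : Disjoint E (⋃ j, C j)) :
    ∃ ε > 0, ∀ j, ∃ a b c d : ℝ, a ≤ b ∧ c ≤ d ∧
      (∀ p ∈ C j, ∀ z, dist z p < ε → z ∈ Icc a b ×ℂ Icc c d) ∧
      Icc a b ×ℂ Icc c d ⊆ UHP \ E ∧ ∀ i, i ≠ j → Disjoint (Icc a b ×ℂ Icc c d) (C i) := by
  have key : ∀ᶠ ε in 𝓝[>] (0 : ℝ), ∀ j, ∃ a b c d : ℝ, a ≤ b ∧ c ≤ d ∧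
      (∀ p ∈ C j, ∀ z, dist z p < ε → z ∈ Icc a b ×ℂ Icc c d) ∧
      Icc a b ×ℂ Icc c d ⊆ UHP \ E ∧
      ∀ i, i ≠ j → Disjoint (Icc a b ×ℂ Icc c d) (C i) := by
    rw [eventually_all]
    intro j
    obtain ⟨a, b, y, hy, hab, hj⟩ := (hC j).exists_rect
    have hUo : IsOpen ((UHP \ E) \ ⋃ i : {i // i ≠ j}, C i) := (isOpen_UHP.sdiff hE).sdiff
      (isCompact_iUnion fun i : {i // i ≠ j} => (hC i).isCompact).isClosed
    have hsub : Icc a b ×ℂ Icc y y ⊆ (UHP \ E) \ ⋃ i : {i // i ≠ j}, C i := by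
      rw [← hj]
      refine fun z hz => ⟨⟨(hC j).subset_UHP hz, fun hzE =>
        disjoint_left.1 hEC hzE (mem_iUnion.2 ⟨j, hz⟩)⟩, fun hz' => ?_⟩
      obtain ⟨⟨i, hij⟩, hi⟩ := mem_iUnion.1 hz'
      exact disjoint_left.1 (hd hij) hi hz
    obtain ⟨ε₀, hε₀, h⟩ := exists_rect_subset hUo hab.le le_rfl hsub
    filter_upwards [Ioo_mem_nhdsGT hε₀] with ε hε
    have hQ := h ε hε.2.le
    have hε0 := hε.1
    refine ⟨a - ε, b + ε, y - ε, y + ε, by linarith, by linarith, ?_,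
      hQ.trans sdiff_subset, fun i hi => disjoint_left.2 fun z hz hzi =>
        (hQ hz).2 (mem_iUnion.2 ⟨⟨i, hi⟩, hzi⟩)⟩
    intro p hp z hz
    rw [hj] at hp
    obtain ⟨⟨h1, h2⟩, h3, h4⟩ := hp
    rw [dist_eq_norm] at hz
    have h5 := abs_lt.1 ((abs_re_le_norm (z - p)).trans_lt hz)
    have h6 := abs_lt.1 ((abs_im_le_norm (z - p)).trans_lt hz)
    rw [sub_re] at h5
    rw [sub_im] at h6
    exact ⟨⟨by linarith, by linarith⟩, by linarith, by linarith⟩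
  obtain ⟨ε, hε, hε0⟩ := (key.and self_mem_nhdsWithin).exists
  exact ⟨ε, hε0, hε⟩

lemma not_isBounded_UHP : ¬ IsBounded UHP := by
  intro h
  obtain ⟨M, hM⟩ := h.exists_norm_le
  have h1 := hM (((|M| + 1 : ℝ) : ℂ) * I) (by simp [UHP]; positivity)
  rw [norm_mul, norm_I, mul_one, norm_real, Real.norm_eq_abs, abs_of_pos (by positivity)] at h1
  linarith [le_abs_self M]

namespace MapOut

variable {N : ℕ} {C : Fin N → Set ℂ} {F D' : Set ℂ} {g : ℂ → ℂ}

/-- A set contained in a small rectangle around a slit separates nothing from infinity. -/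
lemma not_separates_of_subset_rect (h : MapOut C F D' g) {K S : Set ℂ} {a b c d : ℝ} (hab : a ≤ b)
    (hcd : c ≤ d) {j : Fin N} (hj : C j ⊆ Icc a b ×ℂ Icc c d)
    (hQF : Icc a b ×ℂ Icc c d ⊆ UHP \ F)
    (hQC : ∀ i, i ≠ j → Disjoint (Icc a b ×ℂ Icc c d) (C i)) (hK : K ⊆ Icc a b ×ℂ Icc c d)
    (hS : S ⊆ outDom C F) (hSQ : Disjoint S (Icc a b ×ℂ Icc c d)) (hSn : S.Nonempty) :
    ¬ SeparatesFromInfty (outDom C F) K S := by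
  intro hsep
  obtain ⟨z, hz⟩ := hSn
  set Q : Fin N → Set ℂ := Function.update C j (Icc a b ×ℂ Icc c d) with hQ
  have hQj : Q j = Icc a b ×ℂ Icc c d := Function.update_self ..
  have hQi : ∀ i, i ≠ j → Q i = C i := fun i hi => Function.update_of_ne hi ..
  have hCQ : ⋃ i, C i ⊆ ⋃ i, Q i := iUnion_mono fun i => by
    by_cases hi : i = j
    · rw [hi, hQj]; exact hj
    · rw [hQi i hi]
  have hQc : IsCompact (⋃ i, Q i) := isCompact_iUnion fun i => by
    by_cases hi : i = j
    · rw [hi, hQj]; exact isCompact_rect a b c d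
    · rw [hQi i hi]; exact (h.slit i).isCompact
  have hW : IsPreconnected ((UHP \ F) \ ⋃ i, Q i) := by
    refine h.hull.2.2.1.isPreconnected.diff_iUnion_rect (isOpen_hull_compl h.hull) (fun i => ?_)
      (fun i i' hii => ?_) (fun i => Or.inl ?_)
    · by_cases hi : i = j
      · rw [hi, hQj]; exact ⟨a, b, c, d, hab, hcd, rfl⟩
      · rw [hQi i hi]
        obtain ⟨a, b, y, -, hab, hj⟩ := (h.slit i).exists_rect
        exact ⟨a, b, y, y, hab.le, le_rfl, hj⟩
    · change Disjoint (Q i) (Q i')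
      by_cases hi : i = j
      · have hi' : i' ≠ j := fun h => hii (hi.trans h.symm)
        rw [hi, hQj, hQi i' hi']
        exact hQC i' hi'
      · rw [hQi i hi]
        by_cases hi' : i' = j
        · rw [hi', hQj]; exact (hQC i hi).symm
        · rw [hQi i' hi']; exact h.disj hii
    · by_cases hi : i = j
      · rw [hi, hQj]; exact hQF
      · rw [hQi i hi]; exact (subset_iUnion C i).trans h.slits_subset
  have hWG : (UHP \ F) \ ⋃ i, Q i ⊆ outDom C F \ K := by
    rintro w ⟨⟨h1, h2⟩, h3⟩
    exact ⟨⟨⟨h1, fun h4 => h3 (hCQ h4)⟩, h2⟩, fun h4 => h3 (mem_iUnion.2 ⟨j, by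
      rw [hQj]; exact hK h4⟩)⟩
  have hzW : z ∈ (UHP \ F) \ ⋃ i, Q i := by
    refine ⟨⟨(hS hz).1.1, (hS hz).2⟩, fun hzQ => ?_⟩
    obtain ⟨i, hi⟩ := mem_iUnion.1 hzQ
    by_cases hij : i = j
    · rw [hij, hQj] at hi
      exact disjoint_left.1 hSQ hz hi
    · rw [hQi i hij] at hi
      exact (hS hz).1.2 (mem_iUnion.2 ⟨i, hi⟩)
  have hb := (hsep z ⟨hz, hWG hzW⟩).subset (hW.subset_connectedComponentIn hzW hWG)
  refine not_isBounded_UHP (((hb.union hQc.isBounded).union h.bdd).subset fun w hw => ?_)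
  by_cases h1 : w ∈ F
  · exact Or.inr h1
  · by_cases h2 : w ∈ ⋃ i, Q i
    · exact Or.inl (Or.inr h2)
    · exact Or.inl (Or.inl ⟨⟨hw, h1⟩, h2⟩)

end MapOut

section Family

variable {T : ℝ} {N : ℕ} {C : Fin N → Set ℂ} {F Dt : ℝ → Set ℂ} {g : ℝ → ℂ → ℂ}

lemma hull_diff_subset_outDom (hm : ∀ t ∈ Icc 0 T, MapOut C (F t) (Dt t) (g t)) {s t : ℝ}
    (ht : t ∈ Icc 0 T) : F t \ F s ⊆ outDom C (F s) := fun _ hz =>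
  ⟨⟨(hm t ht).hull.1 hz.1, disjoint_left.1 (hm t ht).cldisj (subset_closure hz.1)⟩, hz.2⟩

lemma exists_norm_sub_self_le (hT : 0 < T) (hm : ∀ t ∈ Icc 0 T, MapOut C (F t) (Dt t) (g t))
    (hF : ∀ s ∈ Icc 0 T, ∀ t ∈ Icc 0 T, s ≤ t → F s ⊆ F t) :
    ∃ M, ∀ t ∈ Icc 0 T, ∀ z ∈ outDom C (F t), ‖g t z - z‖ ≤ M := by
  have hTT : T ∈ Icc 0 T := right_mem_Icc.2 hT.le
  obtain ⟨R, hR⟩ := ((isCompact_iUnion_slit (hm T hTT).slit).isBounded.union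
    (hm T hTT).bdd).exists_norm_le
  have hR' : ∀ z ∈ (⋃ j, C j) ∪ F T, z ∈ closedBall (0 : ℂ) (|R| + 1) := fun z hz => by
    rw [mem_closedBall, dist_zero_right]
    linarith [hR z hz, le_abs_self R]
  exact ⟨_, fun t ht => (hm t ht).norm_sub_self_le (r := |R| + 1) (by positivity)
    (fun z hz => hR' z (Or.inr (hF t ht T hTT ht.2 hz))) fun z hz => hR' z (Or.inl hz)⟩

/-- Under local growth, the increments of the hulls are mapped into small disks. -/
lemma exists_image_increment_subset (hT : 0 < T)
    (hm : ∀ t ∈ Icc 0 T, MapOut C (F t) (Dt t) (g t))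
    (hF : ∀ s ∈ Icc 0 T, ∀ t ∈ Icc 0 T, s ≤ t → F s ⊆ F t)
    (hne : ∀ s ∈ Icc 0 T, ∀ t ∈ Icc 0 T, s < t → (F t \ F s).Nonempty)
    (hLG : LocalGrowth T (UHP \ ⋃ j, C j) F) {η : ℝ} (hη : 0 < η) :
    ∃ δ ∈ Ioo 0 T, ∀ t ∈ Icc 0 (T - δ), ∃ x : ℝ,
      g t '' (F (t + δ) \ F t) ⊆ closedBall (x : ℂ) η := by
  have hTT : T ∈ Icc 0 T := right_mem_Icc.2 hT.le
  obtain ⟨M, hM⟩ := exists_norm_sub_self_le hT hm hF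
  obtain ⟨ρ, hρ, hslit⟩ := exists_slit_nhd (hm T hTT).slit (hm T hTT).disj
    (isClosed_closure (s := F T)) (hm T hTT).cldisj
  obtain ⟨ε, hε, hε0, hερ⟩ := ((eventually_lt_mul_log hρ (half_pos hη)
    (2 * Real.pi * (Real.pi * (ρ + M) ^ 2))).and (Ioo_mem_nhdsGT hρ)).exists
  obtain ⟨δ, hδ, hLGδ⟩ := hLG ε hε0
  refine ⟨δ, hδ, fun t ht => ?_⟩
  have htT : t ∈ Icc 0 T := ⟨ht.1, by linarith [ht.2, hδ.1]⟩
  have htδ : t + δ ∈ Icc 0 T := ⟨by linarith [ht.1, hδ.1], by linarith [ht.2]⟩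
  obtain ⟨K, ⟨c, hc, -, hc0, hc1, hc01, rfl⟩, hdiam, hsep⟩ := hLGδ t ht
  change SeparatesFromInfty (outDom C (F t)) _ _ at hsep
  change c '' Ioo 0 1 ⊆ outDom C (F t) at hc01
  have h := hm t htT
  have hfr : ∀ z ∈ frontier (outDom C (F t)), z ∉ outDom C (F t) := fun z hz hz' => by
    have := hz.2
    rw [h.isOpen_dom.interior_eq] at this
    exact this hz'
  have hS : F (t + δ) \ F t ⊆ outDom C (F t) := hull_diff_subset_outDom hm htδ
  have hFT : F t ⊆ closure (F T) := (hF t htT T hTT htT.2).trans subset_closure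
  have hcε : ∀ s ∈ Icc (0 : ℝ) 1, dist (c s) (c 0) < ε := fun s hs =>
    (dist_le_diam_of_mem (isCompact_Icc.image_of_continuousOn hc).isBounded
      (mem_image_of_mem _ hs) (mem_image_of_mem _ (by simp))).trans_lt hdiam
  have hb : c 0 ∉ ⋃ j, C j := by
    intro hb
    obtain ⟨j, hj⟩ := mem_iUnion.1 hb
    obtain ⟨a, b, y, y', hab, hyy, hnhd, hQ, hQC⟩ := hslit j
    refine h.not_separates_of_subset_rect hab hyy (fun p hp => hnhd p hp p (by simpa using hρ))
      (hQ.trans (sdiff_subset_sdiff_right hFT)) hQC ?_ hS ?_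
      (hne t htT _ htδ (by linarith [hδ.1])) hsep
    · rintro _ ⟨s, hs, rfl⟩
      exact hnhd _ hj _ ((hcε s hs).trans hερ)
    · exact disjoint_left.2 fun z hz hzQ =>
        (hQ hzQ).2 (subset_closure (hF _ htδ T hTT htδ.2 hz.1))
  have hball : Disjoint (ball (c 0) ρ) (⋃ j, C j) := by
    refine disjoint_left.2 fun p hp hpC => ?_
    obtain ⟨j, hj⟩ := mem_iUnion.1 hpC
    obtain ⟨a, b, y, y', -, -, hnhd, hQ, -⟩ := hslit j
    have hbQ := hQ (hnhd p hj (c 0) (by rwa [mem_ball, dist_comm] at hp))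
    exact hfr _ hc0 ⟨⟨hbQ.1, hb⟩, fun h' => hbQ.2 (hFT h')⟩
  obtain ⟨x, hx⟩ := h.image_crossCut_subset (hM t htT) hε0 hερ (half_pos hη) hε hc (hfr _ hc0)
    hc01 hcε hball
  refine ⟨x, h.image_subset_closedBall_of_separates hS hsep ?_⟩
  rintro _ ⟨⟨s, hs, rfl⟩, hsG⟩
  have hs0 : s ≠ 0 := fun h0 => hfr _ hc0 (h0 ▸ hsG)
  have hs1 : s ≠ 1 := fun h1 => hfr _ hc1 (h1 ▸ hsG)
  have := hx (mem_image_of_mem _ (mem_image_of_mem c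
    (show s ∈ Ioo (0 : ℝ) 1 from ⟨hs.1.lt_of_ne' hs0, hs.2.lt_of_ne hs1⟩)))
  rwa [show 2 * (η / 2) = η by ring] at this

/-- Mapping-out functions of hulls with a small increment are uniformly close. -/
lemma exists_norm_sub_le_of_image_increment (hT : 0 < T)
    (hm : ∀ t ∈ Icc 0 T, MapOut C (F t) (Dt t) (g t))
    (hF : ∀ s ∈ Icc 0 T, ∀ t ∈ Icc 0 T, s ≤ t → F s ⊆ F t) {ω : ℝ} (hω : 0 < ω) :
    ∃ r > 0, ∀ s ∈ Icc 0 T, ∀ t ∈ Icc 0 T, s ≤ t → ∀ x : ℝ,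
      g s '' (F t \ F s) ⊆ closedBall (x : ℂ) r →
      ∀ z ∈ outDom C (F t), ‖g t z - g s z‖ ≤ ω := by
  have hTT : T ∈ Icc 0 T := right_mem_Icc.2 hT.le
  obtain ⟨M, hM⟩ := exists_norm_sub_self_le hT hm hF
  obtain ⟨m, hm0, hmb⟩ := (hm T hTT).exists_slit_bound
  set ρ := min m (ω / 8) with hρ
  have hρ0 : 0 < ρ := lt_min hm0 (by positivity)
  obtain ⟨r, hr, hr0, hrρ⟩ := ((eventually_lt_mul_log hρ0 (show 0 < ω / 16 by positivity)
    (2 * Real.pi * (Real.pi * (ρ + (M + M)) ^ 2))).and (Ioo_mem_nhdsGT hρ0)).exists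
  refine ⟨r, hr0, fun s hs t ht hst x hx z hz => ?_⟩
  have hsub := hF s hs t ht hst
  have h1 := (hm s hs).norm_sub_le_of_image_subset (hm t ht) hsub (B := M + M)
    hr0 hrρ (by positivity : 0 < ω / 16)
    (fun w hw0 hw => (hm s hs).mem_target_of_im_lt (hm T hTT) (hF s hs T hTT hs.2) hmb hw0
      (hw.trans_le (min_le_left _ _))) hx (fun z hz => by
      rw [show g t z - g s z = (g t z - z) - (g s z - z) by ring]
      exact (norm_sub_le _ _).trans
        (add_le_add (hM t ht z hz) (hM s hs z (MapOut.dom_anti hsub hz)))) hr z hz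
  have h2 : ρ ≤ ω / 8 := min_le_right _ _
  linarith

lemma exists_uniform_increment (hT : 0 < T) (hm : ∀ t ∈ Icc 0 T, MapOut C (F t) (Dt t) (g t))
    (hF : ∀ s ∈ Icc 0 T, ∀ t ∈ Icc 0 T, s ≤ t → F s ⊆ F t)
    (hne : ∀ s ∈ Icc 0 T, ∀ t ∈ Icc 0 T, s < t → (F t \ F s).Nonempty)
    (hLG : LocalGrowth T (UHP \ ⋃ j, C j) F) {ω δ₀ : ℝ} (hω : 0 < ω) (hδ₀ : 0 < δ₀) :
    ∃ δ ∈ Ioo 0 T, δ < δ₀ ∧ ∀ t ∈ Icc 0 (T - δ),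
      (∃ x : ℝ, g t '' (F (t + δ) \ F t) ⊆ closedBall (x : ℂ) ω) ∧
      ∀ t' ∈ Icc t (t + δ), ∀ z ∈ outDom C (F t'), ‖g t' z - g t z‖ ≤ ω := by
  have h0 : (0 : ℝ) ∈ Icc 0 T := left_mem_Icc.2 hT.le
  obtain ⟨r, hr, hB⟩ := exists_norm_sub_le_of_image_increment hT hm hF hω
  have hδ₁ : min δ₀ T ∈ Icc 0 T := ⟨(lt_min hδ₀ hT).le, min_le_right _ _⟩
  obtain ⟨p, hp⟩ := hne 0 h0 _ hδ₁ (lt_min hδ₀ hT)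
  have hpim : 0 < (g 0 p).im := (hm 0 h0).im_pos (hull_diff_subset_outDom hm hδ₁ hp)
  have hη : 0 < min (min ω r) ((g 0 p).im / 2) := lt_min (lt_min hω hr) (half_pos hpim)
  obtain ⟨δ, hδ, hA⟩ := exists_image_increment_subset hT hm hF hne hLG hη
  refine ⟨δ, hδ, ?_, fun t ht => ?_⟩
  · by_contra! hcon
    obtain ⟨x, hx⟩ := hA 0 ⟨le_rfl, by linarith [hδ.2]⟩
    rw [zero_add] at hx
    have hpδ : p ∈ F δ \ F 0 :=
      ⟨hF _ hδ₁ δ ⟨hδ.1.le, hδ.2.le⟩ ((min_le_left _ _).trans hcon) hp.1, hp.2⟩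
    have h1 := hx (mem_image_of_mem _ hpδ)
    rw [mem_closedBall, dist_eq_norm] at h1
    have h2 := (abs_im_le_norm (g 0 p - x)).trans (h1.trans (min_le_right _ _))
    rw [sub_im, ofReal_im, sub_zero, abs_of_pos hpim] at h2
    linarith
  · obtain ⟨x, hx⟩ := hA t ht
    have htT : t ∈ Icc 0 T := ⟨ht.1, by linarith [ht.2, hδ.1]⟩
    have htδ : t + δ ∈ Icc 0 T := ⟨by linarith [ht.1, hδ.1], by linarith [ht.2]⟩
    refine ⟨⟨x, hx.trans (closedBall_subset_closedBall
      ((min_le_left _ _).trans (min_le_left _ _)))⟩, fun t' ht' => ?_⟩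
    have ht'T : t' ∈ Icc 0 T := ⟨ht.1.trans ht'.1, ht'.2.trans htδ.2⟩
    refine hB t htT t' ht'T ht'.1 x ((image_mono (sdiff_subset_sdiff_left
      (hF t' ht'T _ htδ ht'.2))).trans (hx.trans (closedBall_subset_closedBall
      ((min_le_left _ _).trans (min_le_right _ _)))))

end Family

lemma exists_continuousOn_Icc_extension {f : ℝ → ℝ} {T : ℝ} (hT : 0 < T)
    (h : ∀ ω > 0, ∃ δ > 0, ∀ s t, 0 ≤ s → s ≤ t → t < T → t - s < δ → |f t - f s| < ω) :
    ∃ ξ : ℝ → ℝ, ContinuousOn ξ (Icc 0 T) ∧ ∀ t ∈ Ico 0 T, ξ t = f t := by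
  have hu : UniformContinuousOn f (Ico 0 T) := by
    rw [Metric.uniformContinuousOn_iff]
    intro ω hω
    obtain ⟨δ, hδ, hd⟩ := h ω hω
    refine ⟨δ, hδ, fun s hs t ht hst => ?_⟩
    rw [Real.dist_eq] at hst ⊢
    rcases le_total s t with hle | hle
    · rw [abs_sub_comm]
      exact hd s t hs.1 hle ht.2 (by rw [abs_sub_comm] at hst; exact (le_abs_self _).trans_lt hst)
    · exact hd t s ht.1 hle hs.2 ((le_abs_self _).trans_lt hst)
  have hne : (𝓝[Ico 0 T] T).NeBot := by
    rw [← mem_closure_iff_nhdsWithin_neBot, closure_Ico hT.ne]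
    exact right_mem_Icc.2 hT.le
  have hc : Cauchy (𝓝[Ico 0 T] T) := cauchy_nhds.mono nhdsWithin_le_nhds
  obtain ⟨L, hL⟩ := cauchy_map_iff_exists_tendsto.1 (hc.map_of_le hu inf_le_right)
  refine ⟨Function.update f T L, ?_, fun t ht => Function.update_of_ne ht.2.ne _ _⟩
  rw [continuousOn_update_iff, Icc_sdiff_right]
  exact ⟨hu.continuousOn, fun _ => hL⟩

section Family

variable {T : ℝ} {N : ℕ} {C : Fin N → Set ℂ} {F Dt : ℝ → Set ℂ} {g : ℝ → ℂ → ℂ}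

lemma exists_iInter_closure_eq_singleton (hT : 0 < T)
    (hm : ∀ t ∈ Icc 0 T, MapOut C (F t) (Dt t) (g t))
    (hF : ∀ s ∈ Icc 0 T, ∀ t ∈ Icc 0 T, s ≤ t → F s ⊆ F t)
    (hne : ∀ s ∈ Icc 0 T, ∀ t ∈ Icc 0 T, s < t → (F t \ F s).Nonempty)
    (hLG : LocalGrowth T (UHP \ ⋃ j, C j) F) {t : ℝ} (ht : t ∈ Ico 0 T) :
    ∃ x : ℝ, ⋂ δ ∈ Ioc 0 (T - t), closure (g t '' (F (t + δ) \ F t)) = {(x : ℂ)} := by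
  set P := ⋂ δ ∈ Ioc 0 (T - t), closure (g t '' (F (t + δ) \ F t)) with hP
  have htT : t ∈ Icc 0 T := ⟨ht.1, ht.2.le⟩
  have hδT : ∀ δ ∈ Ioc 0 (T - t), t + δ ∈ Icc 0 T := fun δ hδ =>
    ⟨by linarith [ht.1, hδ.1], by linarith [hδ.2]⟩
  obtain ⟨M, hM⟩ := exists_norm_sub_self_le hT hm hF
  have hPne : P.Nonempty := by
    rw [hP, biInter_eq_iInter]
    have : Nonempty (Ioc 0 (T - t)) := ⟨⟨T - t, by linarith [ht.2], le_rfl⟩⟩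
    have hcl : ∀ δ : Ioc 0 (T - t), IsClosed (closure (g t '' (F (t + δ) \ F t))) :=
      fun δ => isClosed_closure
    refine IsCompact.nonempty_iInter_of_directed_nonempty_isCompact_isClosed _ ?_
      (fun δ => ((hne t htT _ (hδT δ δ.2) (by linarith [δ.2.1])).image _).closure)
      (fun δ => ?_) hcl
    · refine directed_of_isDirected_ge fun δ δ' hle => ?_
      exact closure_mono (image_mono (sdiff_subset_sdiff_left (hF _ (hδT δ δ.2) _ (hδT δ' δ'.2)
        (by have : (δ : ℝ) ≤ δ' := hle
            linarith))))
    · refine Metric.isCompact_of_isClosed_isBounded isClosed_closure (IsBounded.closure ?_)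
      obtain ⟨R, hR⟩ := (hm _ (hδT δ δ.2)).bdd.exists_norm_le
      refine isBounded_iff_forall_norm_le.2 ⟨M + R, ?_⟩
      rintro _ ⟨z, hz, rfl⟩
      have h1 := hM t htT z (hull_diff_subset_outDom hm (hδT δ δ.2) hz)
      have h2 := hR z hz.1
      have h3 := norm_add_le (g t z - z) z
      rw [sub_add_cancel] at h3
      linarith
  have hPs : ∀ ω > 0, ∃ x : ℝ, P ⊆ closedBall (x : ℂ) ω := by
    intro ω hω
    obtain ⟨δ, hδ, hδt, h⟩ := exists_uniform_increment hT hm hF hne hLG hω (sub_pos.2 ht.2)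
    obtain ⟨⟨x, hx⟩, -⟩ := h t ⟨ht.1, by linarith⟩
    have hmem : δ ∈ Ioc 0 (T - t) := ⟨hδ.1, hδt.le⟩
    exact ⟨x, fun p hp =>
      closure_minimal hx isClosed_closedBall (mem_iInter₂.1 hp δ hmem)⟩
  obtain ⟨q, hq⟩ := hPne
  have hq0 : q.im = 0 := by
    rw [← abs_eq_zero]
    refine le_antisymm (le_of_forall_pos_le_add fun ω hω => ?_) (abs_nonneg _)
    obtain ⟨x, hx⟩ := hPs ω hω
    have h1 := hx hq
    rw [mem_closedBall, dist_eq_norm] at h1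
    have h2 := (abs_im_le_norm (q - x)).trans h1
    rw [sub_im, ofReal_im, sub_zero] at h2
    linarith
  have hqre : (q.re : ℂ) = q := Complex.ext (by simp) (by simp [hq0])
  refine ⟨q.re, ?_⟩
  rw [hqre]
  refine Subset.antisymm (fun p hp => ?_) (singleton_subset_iff.2 hq)
  rw [mem_singleton_iff, ← dist_le_zero]
  refine le_of_forall_pos_le_add fun ω hω => ?_
  obtain ⟨x, hx⟩ := hPs (ω / 2) (half_pos hω)
  have h1 := mem_closedBall.1 (hx hp)
  have h2 := mem_closedBall.1 (hx hq)
  have := dist_triangle_right p q x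
  linarith

lemma abs_sub_le_of_iInter_closure (hm : ∀ t ∈ Icc 0 T, MapOut C (F t) (Dt t) (g t))
    (hF : ∀ s ∈ Icc 0 T, ∀ t ∈ Icc 0 T, s ≤ t → F s ⊆ F t) {ξ : ℝ → ℝ}
    (hξ : ∀ t ∈ Ico 0 T,
      ⋂ δ ∈ Ioc 0 (T - t), closure (g t '' (F (t + δ) \ F t)) = {(ξ t : ℂ)})
    {δ ω s t x : ℝ} (hω : 0 < ω) (hδ : 0 < δ) (hs0 : 0 ≤ s) (hsδ : s ≤ T - δ) (hst : s ≤ t)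
    (htδ : t < s + δ) (hx : g s '' (F (s + δ) \ F s) ⊆ closedBall (x : ℂ) ω)
    (hts : ∀ z ∈ outDom C (F t), ‖g t z - g s z‖ ≤ ω) : |ξ t - ξ s| ≤ 4 * ω := by
  have hmem : ∀ r ∈ Ico 0 T, ∀ τ ∈ Ioc 0 (T - r),
      (ξ r : ℂ) ∈ closure (g r '' (F (r + τ) \ F r)) := by
    intro r hr τ hτ
    have : (ξ r : ℂ) ∈ ⋂ δ ∈ Ioc 0 (T - r), closure (g r '' (F (r + δ) \ F r)) := by
      rw [hξ r hr]; rfl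
    exact mem_iInter₂.1 this τ hτ
  have hsδT : s + δ ∈ Icc 0 T := ⟨by linarith, by linarith⟩
  have h1 : dist (ξ s : ℂ) x ≤ ω := closure_minimal hx isClosed_closedBall
    (hmem s ⟨hs0, by linarith⟩ δ ⟨hδ, by linarith⟩)
  obtain ⟨_, ⟨z, hz, rfl⟩, hzd⟩ := Metric.mem_closure_iff.1
    (hmem t ⟨by linarith, by linarith⟩ (s + δ - t) ⟨by linarith, by linarith⟩) ω hω
  rw [add_sub_cancel] at hz
  have h2 := hts z (hull_diff_subset_outDom hm hsδT hz)
  have h3 : dist (g s z) x ≤ ω := hx (mem_image_of_mem _ ⟨hz.1, fun h' => hz.2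
    (hF s ⟨hs0, by linarith⟩ t ⟨by linarith, by linarith⟩ hst h')⟩)
  rw [← dist_eq_norm] at h2
  have h4 := dist_triangle4 (ξ t : ℂ) (g t z) (g s z) x
  have h5 := dist_triangle_right (ξ t : ℂ) (ξ s) x
  rw [dist_eq_norm (ξ t : ℂ) (ξ s), ← ofReal_sub, norm_real, Real.norm_eq_abs] at h5
  linarith

lemma exists_driving_function (hT : 0 < T)
    (hm : ∀ t ∈ Icc 0 T, MapOut C (F t) (Dt t) (g t))
    (hF : ∀ s ∈ Icc 0 T, ∀ t ∈ Icc 0 T, s ≤ t → F s ⊆ F t)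
    (hne : ∀ s ∈ Icc 0 T, ∀ t ∈ Icc 0 T, s < t → (F t \ F s).Nonempty)
    (hLG : LocalGrowth T (UHP \ ⋃ j, C j) F) :
    ∃ ξ : ℝ → ℝ, ContinuousOn ξ (Icc 0 T) ∧ ∀ t ∈ Ico 0 T,
      ⋂ δ ∈ Ioc 0 (T - t), closure (g t '' (F (t + δ) \ F t)) = {(ξ t : ℂ)} := by
  choose! f hf using fun t (ht : t ∈ Ico 0 T) =>
    exists_iInter_closure_eq_singleton hT hm hF hne hLG ht
  obtain ⟨ξ, hξc, hξ⟩ := exists_continuousOn_Icc_extension (f := f) hT fun ω hω => by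
    obtain ⟨δ, hδ, -, h⟩ := exists_uniform_increment hT hm hF hne hLG
      (show 0 < ω / 10 by positivity) one_pos
    have step : ∀ s t, 0 ≤ s → s ≤ T - δ → s ≤ t → t < s + δ → |f t - f s| ≤ 4 * (ω / 10) := by
      intro s t hs0 hsδ hst htδ
      obtain ⟨⟨x, hx⟩, hts⟩ := h s ⟨hs0, hsδ⟩
      exact abs_sub_le_of_iInter_closure hm hF hf (by positivity) hδ.1 hs0 hsδ hst htδ hx
        (hts t ⟨hst, htδ.le⟩)
    refine ⟨δ, hδ.1, fun s t hs hst htT hts => ?_⟩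
    rcases le_total s (T - δ) with hsδ | hsδ
    · have := step s t hs hsδ hst (by linarith)
      linarith
    · have h0 : 0 ≤ T - δ := by linarith [hδ.2]
      have h1 := step (T - δ) s h0 le_rfl hsδ (by linarith)
      have h2 := step (T - δ) t h0 le_rfl (hsδ.trans hst) (by linarith)
      have h3 := abs_sub_le (f t) (f (T - δ)) (f s)
      rw [abs_sub_comm (f (T - δ))] at h3
      linarith
  exact ⟨ξ, hξc, fun t ht => by rw [hξ t ht]; exact hf t ht⟩

end Family

/-- under the local growth property, there is a continuous
driving function `ξ` with `⋂_{δ>0} closure (g t (F (t+δ) \ F t)) = {ξ t}`. -/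
theorem statement18 {T : ℝ} (hT : 0 < T)
    {N : ℕ} {Cs : Fin N → Set ℂ}
    (hslit : ∀ j, IsHorizontalSlit (Cs j))
    (hdisj : Pairwise fun i j => Disjoint (Cs i) (Cs j))
    {D : Set ℂ} (hD : D = UHP \ ⋃ j, Cs j)
    {F : ℝ → Set ℂ}
    (hhull : ∀ t ∈ Set.Icc 0 T, IsHHull (F t))
    (hbdd : ∀ t ∈ Set.Icc 0 T, Bornology.IsBounded (F t))
    (hmono : ∀ s ∈ Set.Icc 0 T, ∀ t ∈ Set.Icc 0 T, s < t →
      F s ⊆ F t ∧ F s ≠ F t)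
    (hFD : ∀ t ∈ Set.Icc 0 T, F t ⊆ D)
    (hFs : Disjoint (closure (F T)) (⋃ j, Cs j))
    {Dt : ℝ → Set ℂ} (hDt : ∀ t ∈ Set.Icc 0 T, IsParallelSlitHalfPlane (Dt t))
    {g : ℝ → ℂ → ℂ}
    (hgd : ∀ t ∈ Set.Icc 0 T, DifferentiableOn ℂ (g t) (D \ F t))
    (hgb : ∀ t ∈ Set.Icc 0 T, Set.BijOn (g t) (D \ F t) (Dt t))
    (hgn : ∀ t ∈ Set.Icc 0 T,
      Tendsto (fun z => g t z - z) (cobounded ℂ ⊓ 𝓟 (D \ F t)) (𝓝 0))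
    {ell : ℝ → ℝ}
    (hres : ∀ t ∈ Set.Icc 0 T, ∀ θ : ℝ, 0 < θ → θ < Real.pi / 2 →
      Tendsto (fun z => z * (g t z - z)) (cobounded ℂ ⊓ 𝓟 (Sector θ))
        (𝓝 ((ell t : ℂ))))
    (hLG : LocalGrowth T D F) :
    ∃ ξ : ℝ → ℝ, ContinuousOn ξ (Set.Icc 0 T) ∧
      ∀ t ∈ Set.Ico 0 T,
        (⋂ δ ∈ Set.Ioc 0 (T - t), closure (g t '' (F (t + δ) \ F t)))
          = {((ξ t : ℂ))} := by
  subst hD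
  have hF : ∀ s ∈ Icc 0 T, ∀ t ∈ Icc 0 T, s ≤ t → F s ⊆ F t := by
    intro s hs t ht hst
    rcases hst.eq_or_lt with rfl | hlt
    · exact subset_rfl
    · exact (hmono s hs t ht hlt).1
  have hne : ∀ s ∈ Icc 0 T, ∀ t ∈ Icc 0 T, s < t → (F t \ F s).Nonempty := by
    intro s hs t ht hst
    obtain ⟨h1, h2⟩ := hmono s hs t ht hst
    exact sdiff_nonempty.2 fun h3 => h2 (h1.antisymm h3)
  refine exists_driving_function (Dt := Dt) hT (fun t ht => ?_) hF hne hLG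
  exact ⟨hslit, hdisj, hhull t ht, hbdd t ht,
    hFs.mono_left (closure_mono (hF t ht T (right_mem_Icc.2 hT.le) ht.2)), hDt t ht, hgd t ht,
    hgb t ht, hgn t ht⟩
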